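/- arXiv:1507.01104 — 3 statements merged into one kernel-verified Lean document; each statement's English description precedes it below -/
import Mathlib

section
/- Let ν > -1. Then 𝒟_ν(x)·λ_ν(x) < 𝒲_ν(x) < (α_{ν,1}⁴/(α_{ν,1}⁴ - x⁴))·𝒟_ν(x)·λ_ν(x) for all real x with 0 < |x| < α_{ν,1}, and 𝒥_ν(x)·𝓘_ν(x) < 𝒲_ν(x) < (j_{ν,1}⁴/(j_{ν,1}⁴ - x⁴))·𝒥_ν(x)·𝓘_ν(x) for all real x with 0 < |x| < j_{ν,1}. -/
open Real Set

/-- Bessel function of the first kind `J_ν(x)` (series definition, intended for `x > 0`). -/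
noncomputable def besselJ (ν x : ℝ) : ℝ :=
  ∑' n : ℕ, (-1 : ℝ) ^ n * (x / 2) ^ (ν + 2 * (n : ℝ)) /
    ((n.factorial : ℝ) * Real.Gamma (ν + n + 1))

/-- Modified Bessel function of the first kind `I_ν(x)` (series definition, for `x > 0`). -/
noncomputable def besselI (ν x : ℝ) : ℝ :=
  ∑' n : ℕ, (x / 2) ^ (ν + 2 * (n : ℝ)) /
    ((n.factorial : ℝ) * Real.Gamma (ν + n + 1))

/-- The cross-product `W_ν(x) = J_{ν+1}(x) I_ν(x) + J_ν(x) I_{ν+1}(x)`. -/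
noncomputable def crossW (ν x : ℝ) : ℝ :=
  besselJ (ν + 1) x * besselI ν x + besselJ ν x * besselI (ν + 1) x

/-- The normalized cross-product `𝒲_ν`, an even entire function of `x`. -/
noncomputable def Wcal (ν x : ℝ) : ℝ :=
  ∑' n : ℕ, (-1 : ℝ) ^ n * (Real.Gamma (ν + 1) * Real.Gamma (ν + 2)) * x ^ (4 * n) /
    ((2 : ℝ) ^ (4 * n) * (n.factorial : ℝ) * Real.Gamma (ν + n + 1) * Real.Gamma (ν + 2 * n + 2))

/-- The normalized Dini function `𝒟_ν`. -/
noncomputable def Dcal (ν x : ℝ) : ℝ :=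
  ∑' n : ℕ, (-1 : ℝ) ^ n * (2 * (n : ℝ) + 1) * Real.Gamma (ν + 1) * x ^ (2 * n) /
    ((2 : ℝ) ^ (2 * n) * (n.factorial : ℝ) * Real.Gamma (ν + n + 1))

/-- The normalized modified Dini function `λ_ν`. -/
noncomputable def lamDini (ν x : ℝ) : ℝ :=
  ∑' n : ℕ, (2 * (n : ℝ) + 1) * Real.Gamma (ν + 1) * x ^ (2 * n) /
    ((2 : ℝ) ^ (2 * n) * (n.factorial : ℝ) * Real.Gamma (ν + n + 1))

/-- The normalized Bessel function `𝒥_ν`. -/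
noncomputable def Jcal (ν x : ℝ) : ℝ :=
  ∑' n : ℕ, (-1 : ℝ) ^ n * Real.Gamma (ν + 1) * x ^ (2 * n) /
    ((2 : ℝ) ^ (2 * n) * (n.factorial : ℝ) * Real.Gamma (ν + n + 1))

/-- The normalized modified Bessel function `𝓘_ν`. -/
noncomputable def Ical (ν x : ℝ) : ℝ :=
  ∑' n : ℕ, Real.Gamma (ν + 1) * x ^ (2 * n) /
    ((2 : ℝ) ^ (2 * n) * (n.factorial : ℝ) * Real.Gamma (ν + n + 1))

/-- A function is absolutely monotonic on a set if it is infinitely differentiable there and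
all of its (iterated) derivatives are nonnegative there. -/
def AbsolutelyMonotonicOn (f : ℝ → ℝ) (s : Set ℝ) : Prop :=
  ContDiffOn ℝ (⊤ : ℕ∞) f s ∧ ∀ (k : ℕ), ∀ x ∈ s, 0 ≤ iteratedDerivWithin k f s x

section WpbHelpers

open Filter Topology


theorem wpb_alg (R V T U z : ℝ) (hR : 0 ≤ R) (hT : 0 ≤ T) (hz : 0 ≤ z)
    (h1 : V ^ 2 ≤ R * T) (h2 : z * R ≤ T) :
    (T - z * R) * (U ^ 2 - z * T ^ 2) ≤ (U - z * V) ^ 2 * T := by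
  have key : 0 ≤ T ^ 3 + R * U ^ 2 - 2 * T * U * V + z * T * (V ^ 2 - R * T) := by
    rcases hR.eq_or_lt with h0 | hpos
    · subst h0
      have hV : V = 0 := by
        have : V ^ 2 ≤ 0 := by simpa using h1
        exact pow_eq_zero_iff (two_ne_zero) |>.1 (le_antisymm this (sq_nonneg V))
      subst hV
      have := pow_nonneg hT 3
      nlinarith
    · have : 0 ≤ R * (T ^ 3 + R * U ^ 2 - 2 * T * U * V + z * T * (V ^ 2 - R * T)) := by
        have e : R * (T ^ 3 + R * U ^ 2 - 2 * T * U * V + z * T * (V ^ 2 - R * T))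
          = (R * U - T * V) ^ 2 + T * ((R * T - V ^ 2) * (T - z * R)) := by ring
        rw [e]
        have := mul_nonneg hT (mul_nonneg (sub_nonneg.2 h1) (sub_nonneg.2 h2))
        positivity
      exact nonneg_of_mul_nonneg_right this hpos
  have := mul_nonneg hz key
  nlinarith

theorem wpb_psd (U V T a b d : ℝ) (hU : 0 ≤ U) (hV : 0 ≤ V) (ha : 0 ≤ a) (hb : 0 ≤ b)
    (h1 : T ^ 2 ≤ U * V) (h2 : d ^ 2 ≤ a * b) : 2 * (T * d) ≤ U * b + V * a := by
  have hR : 0 ≤ U * b + V * a := add_nonneg (mul_nonneg hU hb) (mul_nonneg hV ha)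
  apply le_trans (le_abs_self _)
  apply abs_le_of_sq_le_sq _ hR
  have h3 : T ^ 2 * d ^ 2 ≤ (U * V) * (a * b) :=
    mul_le_mul h1 h2 (sq_nonneg d) (mul_nonneg hU hV)
  nlinarith [sq_nonneg (U * b - V * a)]

/-- Finite version of the Dini upper bound. -/
theorem wpb_moment {κ : Type*} [Fintype κ] (w τ : κ → ℝ) (s ρ : ℝ) (hρ : 0 < ρ) (hs : 0 < s)
    (hw : ∀ i, 0 ≤ w i) (hτ : ∀ i, 0 ≤ τ i) (hτs : ∀ i, τ i * s < 1)
    (hΩ : ∑ i, w i * τ i = 1 / ρ) :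
    ((∑ i, w i * τ i / (1 - τ i ^ 2 * s ^ 2)) - ρ * ∑ i, w i * τ i ^ 2 / (1 - τ i ^ 2 * s ^ 2))
     + ρ * s ^ 2 * ((∑ i, w i * τ i / (1 - τ i ^ 2 * s ^ 2)) * (∑ i, w i * τ i ^ 3 / (1 - τ i ^ 2 * s ^ 2))
        - (∑ i, w i * τ i ^ 2 / (1 - τ i ^ 2 * s ^ 2)) ^ 2) ≤
     ρ ^ 2 * (∑ i, w i * (τ i * (1 - ρ * τ i))) *
      ((∑ i, w i * τ i / (1 - τ i * s)) * (∑ i, w i * τ i / (1 + τ i * s))) := by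
  have hp : ∀ i, 0 < 1 - τ i * s := fun i => by linarith [hτs i]
  have hm : ∀ i, 0 < 1 + τ i * s := fun i => by have := mul_nonneg (hτ i) hs.le; linarith
  have hq : ∀ i, 0 < 1 - τ i ^ 2 * s ^ 2 := fun i => by
    have := mul_pos (hp i) (hm i); nlinarith
  set U := ∑ i, w i * τ i / (1 - τ i ^ 2 * s ^ 2) with hU
  set T := ∑ i, w i * τ i ^ 2 / (1 - τ i ^ 2 * s ^ 2) with hT
  set V := ∑ i, w i * τ i ^ 3 / (1 - τ i ^ 2 * s ^ 2) with hV
  set R := ∑ i, w i * τ i ^ 4 / (1 - τ i ^ 2 * s ^ 2) with hR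
  have eX : ∑ i, w i * τ i / (1 - τ i * s) = U + s * T := by
    rw [hU, hT, Finset.mul_sum, ← Finset.sum_add_distrib]
    refine Finset.sum_congr rfl fun i _ => ?_
    have := (hp i).ne'; have := (hq i).ne'
    field_simp
    ring
  have eY : ∑ i, w i * τ i / (1 + τ i * s) = U - s * T := by
    rw [hU, hT, Finset.mul_sum, ← Finset.sum_sub_distrib]
    refine Finset.sum_congr rfl fun i _ => ?_
    have := (hm i).ne'; have := (hq i).ne'
    field_simp
    ring
  have eS : ∑ i, w i * τ i ^ 2 = T - s ^ 2 * R := by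
    rw [hR, hT, Finset.mul_sum, ← Finset.sum_sub_distrib]
    refine Finset.sum_congr rfl fun i _ => ?_
    have := (hq i).ne'
    field_simp
  have eO : ∑ i, w i * τ i = U - s ^ 2 * V := by
    rw [hU, hV, Finset.mul_sum, ← Finset.sum_sub_distrib]
    refine Finset.sum_congr rfl fun i _ => ?_
    have := (hq i).ne'
    field_simp
  have eK : ∑ i, w i * (τ i * (1 - ρ * τ i)) = ∑ i, w i * τ i - ρ * ∑ i, w i * τ i ^ 2 := by
    rw [Finset.mul_sum, ← Finset.sum_sub_distrib]
    refine Finset.sum_congr rfl fun i _ => ?_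
    ring
  have nR : 0 ≤ R := Finset.sum_nonneg fun i _ => div_nonneg (mul_nonneg (hw i) (pow_nonneg (hτ i) _)) (hq i).le
  have nT : 0 ≤ T := Finset.sum_nonneg fun i _ => div_nonneg (mul_nonneg (hw i) (pow_nonneg (hτ i) _)) (hq i).le
  have cs : V ^ 2 ≤ R * T := by
    apply Finset.sum_sq_le_sum_mul_sum_of_sq_le_mul
    · intro i _; exact div_nonneg (mul_nonneg (hw i) (pow_nonneg (hτ i) _)) (hq i).le
    · intro i _; exact div_nonneg (mul_nonneg (hw i) (pow_nonneg (hτ i) _)) (hq i).le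
    · intro i _; exact le_of_eq (by ring)
  have hS0 : s ^ 2 * R ≤ T := by
    have : 0 ≤ ∑ i, w i * τ i ^ 2 := Finset.sum_nonneg fun i _ => mul_nonneg (hw i) (pow_nonneg (hτ i) _)
    linarith
  have main := wpb_alg R V T U (s ^ 2) nR nT (sq_nonneg s) cs hS0
  rw [eX, eY, eK, hΩ, eS]
  rw [eO] at hΩ
  have hVe : s ^ 2 * V = U - 1 / ρ := by linarith
  rw [hΩ] at main
  have e1 : ρ ^ 2 * (1 / ρ - ρ * (T - s ^ 2 * R)) * ((U + s * T) * (U - s * T))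
     = ρ * (U ^ 2 - s ^ 2 * T ^ 2) - ρ ^ 3 * ((T - s ^ 2 * R) * (U ^ 2 - s ^ 2 * T ^ 2)) := by
    field_simp
    ring
  have e2 : ρ ^ 3 * ((1 / ρ) ^ 2 * T) = ρ * T := by field_simp
  have h3 := mul_le_mul_of_nonneg_left main (pow_pos hρ 3).le
  rw [e2] at h3
  rw [e1]
  have e3 : ρ * s ^ 2 * (U * V - T ^ 2) = ρ * (U ^ 2 - s ^ 2 * T ^ 2) - U := by
    have : ρ * s ^ 2 * (U * V - T ^ 2) = ρ * U * (s ^ 2 * V) - ρ * s ^ 2 * T ^ 2 := by ring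
    rw [this, hVe]; field_simp; ring
  rw [e3]
  linarith

theorem wpb_fin_dini {ι : Type*} [Fintype ι] (t : ι → ℝ) (s ρ : ℝ) (hs : 0 < s) (hsρ : s < ρ)
    (ht : ∀ i, 0 ≤ t i) (htρ : ∀ i, t i * ρ < 1)
    (hδ : 0 ≤ 1 - 2 * ρ * ∑ i, t i / (1 - t i * ρ)) :
    (ρ ^ 2 - s ^ 2) * ((∑ i, t i / (1 - t i * s)) + (∑ i, t i / (1 + t i * s))
      + 4 * ρ * s ^ 2 * ((∑ i, t i) * (∑ i, t i ^ 3) - (∑ i, t i ^ 2) ^ 2)) ≤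
    ρ ^ 2 * (2 * ∑ i, t i) * ((1 - 2 * s * ∑ i, t i / (1 - t i * s)) *
      (1 + 2 * s * ∑ i, t i / (1 + t i * s))) := by
  have hρ : 0 < ρ := hs.trans hsρ
  have hts : ∀ i, t i * s < 1 := fun i =>
    lt_of_le_of_lt (mul_le_mul_of_nonneg_left hsρ.le (ht i)) (htρ i)
  have hp : ∀ i, 0 < 1 - t i * s := fun i => by linarith [hts i]
  have hpρ : ∀ i, 0 < 1 - t i * ρ := fun i => by linarith [htρ i]
  have hm : ∀ i, 0 < 1 + t i * s := fun i => by have := mul_nonneg (ht i) hs.le; linarith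
  have hq : ∀ i, 0 < 1 - t i ^ 2 * s ^ 2 := fun i => by
    have := mul_pos (hp i) (hm i); nlinarith
  set δ := 1 - 2 * ρ * ∑ i, t i / (1 - t i * ρ) with hδd
  let τ : Option ι → ℝ := fun o => o.elim (1 / ρ) t
  let w : Option ι → ℝ := fun o => o.elim δ (fun i => 2 / (1 - t i * ρ))
  have hw : ∀ o, 0 ≤ w o := by
    rintro (_ | i)
    · exact hδ
    · exact div_nonneg zero_le_two (hpρ i).le
  have hτ : ∀ o, 0 ≤ τ o := by
    rintro (_ | i)
    · exact (one_div_pos.2 hρ).le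
    · exact ht i
  have hτs : ∀ o, τ o * s < 1 := by
    rintro (_ | i)
    · change 1 / ρ * s < 1
      rw [one_div, inv_mul_lt_iff₀ hρ]; linarith
    · exact hts i
  have hρs : ρ - s ≠ 0 := by linarith
  have hρs' : ρ + s ≠ 0 := by linarith
  have hΩ : ∑ o, w o * τ o = 1 / ρ := by
    rw [Fintype.sum_option]
    change δ * (1 / ρ) + ∑ i, 2 / (1 - t i * ρ) * t i = 1 / ρ
    have : ∑ i, 2 / (1 - t i * ρ) * t i = 2 * ∑ i, t i / (1 - t i * ρ) := by
      rw [Finset.mul_sum]; exact Finset.sum_congr rfl fun i _ => by ring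
    rw [this, hδd]; field_simp; ring
  have hX : ∑ o, w o * τ o / (1 - τ o * s) = (1 - 2 * s * ∑ i, t i / (1 - t i * s)) / (ρ - s) := by
    rw [Fintype.sum_option]
    change δ * (1 / ρ) / (1 - 1 / ρ * s) + ∑ i, 2 / (1 - t i * ρ) * t i / (1 - t i * s) = _
    have : ∑ i, 2 / (1 - t i * ρ) * t i / (1 - t i * s) =
        (2 * ρ * ∑ i, t i / (1 - t i * ρ) - 2 * s * ∑ i, t i / (1 - t i * s)) / (ρ - s) := by
      rw [Finset.mul_sum, Finset.mul_sum, ← Finset.sum_sub_distrib, Finset.sum_div]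
      refine Finset.sum_congr rfl fun i _ => ?_
      have := (hp i).ne'; have := (hpρ i).ne'
      field_simp; ring
    have e : δ * (1 / ρ) / (1 - 1 / ρ * s) = δ / (ρ - s) := by
      have : 1 - 1 / ρ * s ≠ 0 := by
        have := hτs none
        change 1 / ρ * s < 1 at this
        linarith
      field_simp
    rw [this, e, hδd, ← add_div]; congr 1; ring
  have hY : ∑ o, w o * τ o / (1 + τ o * s) = (1 + 2 * s * ∑ i, t i / (1 + t i * s)) / (ρ + s) := by
    rw [Fintype.sum_option]
    change δ * (1 / ρ) / (1 + 1 / ρ * s) + ∑ i, 2 / (1 - t i * ρ) * t i / (1 + t i * s) = _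
    have : ∑ i, 2 / (1 - t i * ρ) * t i / (1 + t i * s) =
        (2 * ρ * ∑ i, t i / (1 - t i * ρ) + 2 * s * ∑ i, t i / (1 + t i * s)) / (ρ + s) := by
      rw [Finset.mul_sum, Finset.mul_sum, ← Finset.sum_add_distrib, Finset.sum_div]
      refine Finset.sum_congr rfl fun i _ => ?_
      have := (hm i).ne'; have := (hpρ i).ne'
      field_simp; ring
    have e : δ * (1 / ρ) / (1 + 1 / ρ * s) = δ / (ρ + s) := by
      have : 1 + 1 / ρ * s ≠ 0 := by positivity
      field_simp
    rw [this, e, hδd, ← add_div]; congr 1; ring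
  have hK : ∑ o, w o * (τ o * (1 - ρ * τ o)) = 2 * ∑ i, t i := by
    rw [Fintype.sum_option]
    change δ * (1 / ρ * (1 - ρ * (1 / ρ))) + ∑ i, 2 / (1 - t i * ρ) * (t i * (1 - ρ * t i)) = _
    rw [mul_one_div_cancel hρ.ne', Finset.mul_sum]
    simp only [sub_self, mul_zero, zero_add]
    refine Finset.sum_congr rfl fun i _ => ?_
    have := (hpρ i).ne'
    field_simp
  have main := wpb_moment w τ s ρ hρ hs hw hτ hτs hΩ
  have hqτ : ∀ o, 0 < 1 - τ o ^ 2 * s ^ 2 := fun o => by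
    have h1 := hτs o
    have h2 := mul_nonneg (hτ o) hs.le
    nlinarith
  rw [hX, hY, hK] at main
  set U := ∑ i, w i * τ i / (1 - τ i ^ 2 * s ^ 2) with hU
  set T := ∑ i, w i * τ i ^ 2 / (1 - τ i ^ 2 * s ^ 2) with hT
  set V := ∑ i, w i * τ i ^ 3 / (1 - τ i ^ 2 * s ^ 2) with hV
  have hUT : U - ρ * T = (∑ i, t i / (1 - t i * s)) + (∑ i, t i / (1 + t i * s)) := by
    have : U - ρ * T = ∑ o, w o * (τ o * (1 - ρ * τ o)) / (1 - τ o ^ 2 * s ^ 2) := by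
      rw [hU, hT, Finset.mul_sum, ← Finset.sum_sub_distrib]
      exact Finset.sum_congr rfl fun i _ => by ring
    rw [this, Fintype.sum_option]
    change δ * (1 / ρ * (1 - ρ * (1 / ρ))) / _ +
      ∑ i, 2 / (1 - t i * ρ) * (t i * (1 - ρ * t i)) / (1 - t i ^ 2 * s ^ 2) = _
    rw [mul_one_div_cancel hρ.ne', ← Finset.sum_add_distrib]
    simp only [sub_self, mul_zero, zero_add, zero_div]
    refine Finset.sum_congr rfl fun i _ => ?_
    have := (hpρ i).ne'; have := (hp i).ne'; have := (hm i).ne'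
    have e : 1 - t i ^ 2 * s ^ 2 = (1 - t i * s) * (1 + t i * s) := by ring
    rw [e]
    field_simp; ring
  -- slack
  let v : Option ι → ℝ := fun o => o.elim (w none / (1 - τ none ^ 2 * s ^ 2))
    (fun i => w (some i) / (1 - τ (some i) ^ 2 * s ^ 2) - 2)
  have hv : ∀ o, 0 ≤ v o := by
    rintro (_ | i)
    · exact div_nonneg (hw _) (hqτ _).le
    · change 0 ≤ 2 / (1 - t i * ρ) / (1 - t i ^ 2 * s ^ 2) - 2
      rw [sub_nonneg, div_div, le_div_iff₀ (mul_pos (hpρ i) (hq i))]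
      have a1 : 1 - t i * ρ ≤ 1 := by have := mul_nonneg (ht i) hρ.le; linarith
      have a2 : 1 - t i ^ 2 * s ^ 2 ≤ 1 := by have := mul_nonneg (sq_nonneg (t i)) (sq_nonneg s); linarith
      have := mul_le_one₀ a1 (hq i).le a2
      linarith
  have split : ∀ k : ℕ, ∑ o, w o * τ o ^ k / (1 - τ o ^ 2 * s ^ 2) =
      ∑ o, v o * τ o ^ k + 2 * ∑ i, t i ^ k := by
    intro k
    rw [Fintype.sum_option, Fintype.sum_option, Finset.mul_sum, add_assoc, ← Finset.sum_add_distrib]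
    congr 1
    · change _ = w none / (1 - τ none ^ 2 * s ^ 2) * _
      ring
    · refine Finset.sum_congr rfl fun i _ => ?_
      change _ = (w (some i) / (1 - τ (some i) ^ 2 * s ^ 2) - 2) * τ (some i) ^ k + 2 * τ (some i) ^ k
      ring
  have sU := split 1
  have sT := split 2
  have sV := split 3
  simp only [pow_one] at sU
  rw [← hU] at sU
  rw [← hT] at sT
  rw [← hV] at sV
  have cs1 : (∑ o, v o * τ o ^ 2) ^ 2 ≤ (∑ o, v o * τ o) * (∑ o, v o * τ o ^ 3) := by
    apply Finset.sum_sq_le_sum_mul_sum_of_sq_le_mul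
    · intro i _; exact mul_nonneg (hv i) (hτ i)
    · intro i _; exact mul_nonneg (hv i) (pow_nonneg (hτ i) _)
    · intro i _; exact le_of_eq (by ring)
  have cs2 : (∑ i, t i ^ 2) ^ 2 ≤ (∑ i, t i) * (∑ i, t i ^ 3) := by
    apply Finset.sum_sq_le_sum_mul_sum_of_sq_le_mul
    · intro i _; exact ht i
    · intro i _; exact pow_nonneg (ht i) _
    · intro i _; exact le_of_eq (by ring)
  have cs3 := wpb_psd _ _ _ _ _ _
    (Finset.sum_nonneg fun i _ => mul_nonneg (hv i) (hτ i))
    (Finset.sum_nonneg fun i _ => mul_nonneg (hv i) (pow_nonneg (hτ i) 3))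
    (Finset.sum_nonneg fun i _ => ht i)
    (Finset.sum_nonneg fun i _ => pow_nonneg (ht i) 3) cs1 cs2
  have slack : 4 * ((∑ i, t i) * (∑ i, t i ^ 3) - (∑ i, t i ^ 2) ^ 2) ≤ U * V - T ^ 2 := by
    rw [sU, sT, sV]; nlinarith
  have hzz : 0 < ρ ^ 2 - s ^ 2 := by nlinarith
  rw [hUT] at main
  have h4 := mul_le_mul_of_nonneg_left slack (by positivity : 0 ≤ ρ * s ^ 2)
  have h5 := le_trans (by linarith : ((∑ i, t i / (1 - t i * s)) + (∑ i, t i / (1 + t i * s))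
      + 4 * ρ * s ^ 2 * ((∑ i, t i) * (∑ i, t i ^ 3) - (∑ i, t i ^ 2) ^ 2)) ≤ _) main
  have h6 := mul_le_mul_of_nonneg_left h5 hzz.le
  refine h6.trans (le_of_eq ?_)
  have e : ρ ^ 2 - s ^ 2 = (ρ - s) * (ρ + s) := by ring
  rw [e]
  field_simp

theorem wpb_fin_low {ι : Type*} [Fintype ι] (t : ι → ℝ) (s : ℝ) (hs : 0 < s)
    (ht : ∀ i, 0 ≤ t i) (hts : ∀ i, t i * s < 1) :
    2 * (∑ i, t i) + 2 * s ^ 2 * (∑ i, t i ^ 3) ≤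
      (∑ i, t i / (1 - t i * s)) + (∑ i, t i / (1 + t i * s)) := by
  rw [Finset.mul_sum, Finset.mul_sum, ← Finset.sum_add_distrib, ← Finset.sum_add_distrib]
  refine Finset.sum_le_sum fun i _ => ?_
  have h0 := mul_nonneg (ht i) hs.le
  have hp : 0 < 1 - t i * s := by linarith [hts i]
  have hm : 0 < 1 + t i * s := by linarith
  have e : t i / (1 - t i * s) + t i / (1 + t i * s) - (2 * t i + 2 * s ^ 2 * t i ^ 3)
    = 2 * t i * (t i * s) ^ 4 / ((1 - t i * s) * (1 + t i * s)) := by field_simp; ring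
  have : 0 ≤ 2 * t i * (t i * s) ^ 4 / ((1 - t i * s) * (1 + t i * s)) :=
    div_nonneg (mul_nonneg (mul_nonneg zero_le_two (ht i)) (by positivity)) (mul_pos hp hm).le
  linarith

theorem wpb_fin_up {ι : Type*} [Fintype ι] (t : ι → ℝ) (s ρ : ℝ) (hs : 0 < s) (hsρ : s < ρ)
    (ht : ∀ i, 0 ≤ t i) (htρ : ∀ i, t i * ρ < 1) :
    (ρ ^ 2 - s ^ 2) * ((∑ i, t i / (1 - t i * s)) + (∑ i, t i / (1 + t i * s))) ≤
      2 * ρ ^ 2 * (∑ i, t i) - 2 * s ^ 2 * ((∑ i, t i) - ρ ^ 2 * ∑ i, t i ^ 3) := by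
  rw [← Finset.sum_add_distrib, Finset.mul_sum, Finset.mul_sum, Finset.mul_sum (a := ρ ^ 2), ← Finset.sum_sub_distrib,
    Finset.mul_sum, ← Finset.sum_sub_distrib]
  refine Finset.sum_le_sum fun i _ => ?_
  have h0 := mul_nonneg (ht i) hs.le
  have hp : 0 < 1 - t i * s := by nlinarith [htρ i, ht i]
  have hm : 0 < 1 + t i * s := by linarith
  have hr : 0 ≤ t i * ρ := by nlinarith [ht i]
  have e : 2 * ρ ^ 2 * t i - 2 * s ^ 2 * (t i - ρ ^ 2 * t i ^ 3) -
      (ρ ^ 2 - s ^ 2) * (t i / (1 - t i * s) + t i / (1 + t i * s))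
    = 2 * t i * s ^ 2 * (1 - (t i * ρ) ^ 2) * (t i * s) ^ 2 / ((1 - t i * s) * (1 + t i * s)) := by
    field_simp; ring
  have : 0 ≤ 2 * t i * s ^ 2 * (1 - (t i * ρ) ^ 2) * (t i * s) ^ 2 / ((1 - t i * s) * (1 + t i * s)) := by
    have h1 : 0 ≤ 1 - (t i * ρ) ^ 2 := by nlinarith [htρ i]
    have := ht i
    have := mul_pos hp hm
    positivity
  linarith


theorem wpb_eval_prod {K ι : Type*} [Field K] (S : Finset ι) (t : ι → K) (z : K) :
    (∏ i ∈ S, (1 - Polynomial.C (t i) * Polynomial.X)).eval z = ∏ i ∈ S, (1 - t i * z) := by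
  simp [Polynomial.eval_prod]

theorem wpb_eval_deriv {K ι : Type*} [Field K] (S : Finset ι) (t : ι → K) (z : K)
    (hz : ∀ i ∈ S, 1 - t i * z ≠ 0) :
    (Polynomial.derivative (∏ i ∈ S, (1 - Polynomial.C (t i) * Polynomial.X))).eval z =
      -((∏ i ∈ S, (1 - t i * z)) * ∑ i ∈ S, t i / (1 - t i * z)) := by
  classical
  induction S using Finset.induction_on with
  | empty => simp
  | insert a S ha ih =>
    have ih' := ih fun i hi => hz i (Finset.mem_insert_of_mem hi)
    have h0 := hz a (Finset.mem_insert_self a S)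
    rw [Finset.prod_insert ha, Finset.prod_insert ha, Finset.sum_insert ha, Polynomial.derivative_mul]
    simp only [Polynomial.eval_add, Polynomial.eval_mul, ih', wpb_eval_prod]
    simp only [Polynomial.derivative_sub, Polynomial.derivative_one, Polynomial.derivative_C_mul,
      Polynomial.derivative_X, Polynomial.eval_sub, Polynomial.eval_one, Polynomial.eval_mul,
      Polynomial.eval_C, Polynomial.eval_X, Polynomial.eval_zero]
    generalize (∏ i ∈ S, (1 - t i * z)) = P
    generalize (∑ i ∈ S, t i / (1 - t i * z)) = Q
    field_simp
    ring

theorem wpb_root_step {ι : Type*} [Fintype ι] (t : ι → ℝ) (ht : ∀ i, 0 < t i) (k : ℝ) (hk : 0 < k)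
    (z : ℂ) (hz : z * (Polynomial.derivative (∏ i, (1 - Polynomial.C (t i : ℂ) * Polynomial.X))).eval z
      + (k - z) * (∏ i, (1 - Polynomial.C (t i : ℂ) * Polynomial.X)).eval z = 0) :
    ∃ r : ℝ, 0 < r ∧ z = r := by
  by_cases h : ∀ i ∈ (Finset.univ : Finset ι), 1 - (t i : ℂ) * z ≠ 0
  · rw [wpb_eval_deriv _ _ _ h, wpb_eval_prod] at hz
    have hne : ∏ i, (1 - (t i : ℂ) * z) ≠ 0 := Finset.prod_ne_zero_iff.2 h
    have h1 : (k - z) - z * ∑ i, (t i : ℂ) / (1 - t i * z) = 0 := by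
      apply mul_left_cancel₀ hne
      rw [mul_zero, ← hz]; ring
    rw [Finset.mul_sum] at h1
    have hterm : ∀ i, (z * ((t i : ℂ) / (1 - t i * z))).im = t i * z.im / Complex.normSq (1 - t i * z) := by
      intro i
      have hi := h i (Finset.mem_univ i)
      have : z * ((t i : ℂ) / (1 - t i * z)) = (1 - t i * z)⁻¹ - 1 := by
        rw [eq_sub_iff_add_eq]
        apply eq_inv_of_mul_eq_one_left
        rw [add_mul, mul_assoc, div_mul_cancel₀ _ hi]
        ring
      rw [this, Complex.sub_im, Complex.inv_im]
      simp
    have him := congrArg Complex.im h1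
    rw [Complex.sub_im, Complex.im_sum] at him
    simp only [hterm, Complex.sub_im, Complex.ofReal_im, Complex.zero_im] at him
    have hfac : z.im * (1 + ∑ i, t i / Complex.normSq (1 - t i * z)) = 0 := by
      have : ∑ i, t i * z.im / Complex.normSq (1 - t i * z) =
          z.im * ∑ i, t i / Complex.normSq (1 - t i * z) := by
        rw [Finset.mul_sum]; exact Finset.sum_congr rfl fun i _ => by ring
      rw [this] at him; linarith
    have hpos : 0 ≤ ∑ i, t i / Complex.normSq (1 - t i * z) :=
      Finset.sum_nonneg fun i _ => div_nonneg (ht i).le (Complex.normSq_nonneg _)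
    have him0 : z.im = 0 := by
      rcases mul_eq_zero.1 hfac with h | h
      · exact h
      · linarith
    have hzr : z = (z.re : ℂ) := by apply Complex.ext <;> simp [him0]
    refine ⟨z.re, ?_, hzr⟩
    by_contra hneg
    push Not at hneg
    set r := z.re
    rw [hzr] at h1
    have h2 : (k - r) - ∑ i, r * (t i / (1 - t i * r)) = 0 := by exact_mod_cast h1
    have h3 : ∑ i, r * (t i / (1 - t i * r)) ≤ 0 := by
      refine Finset.sum_nonpos fun i _ => ?_
      apply mul_nonpos_of_nonpos_of_nonneg hneg
      apply div_nonneg (ht i).le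
      nlinarith [ht i]
    linarith
  · push Not at h
    obtain ⟨i, _, hi⟩ := h
    refine ⟨1 / t i, one_div_pos.2 (ht i), ?_⟩
    have : (t i : ℂ) ≠ 0 := by exact_mod_cast (ht i).ne'
    push_cast
    field_simp
    linear_combination -hi

theorem wpb_factor (q : Polynomial ℝ) (h0 : q.eval 0 = 1)
    (hr : ∀ z : ℂ, (q.map Complex.ofRealHom).eval z = 0 → ∃ r : ℝ, 0 < r ∧ z = r) :
    ∃ (k : ℕ) (t : Fin k → ℝ), (∀ i, 0 < t i) ∧
      q = ∏ i, (1 - Polynomial.C (t i) * Polynomial.X) := by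
  set Q := q.map Complex.ofRealHom with hQ
  have hs : Q.Splits := IsAlgClosed.splits Q
  have hQ0 : Q.eval 0 = 1 := by
    have : Q.eval (Complex.ofRealHom 0) = Complex.ofRealHom (q.eval 0) := Polynomial.eval_map_apply ..
    simpa [h0] using this
  have hQne : Q ≠ 0 := by rintro h; rw [h] at hQ0; simp at hQ0
  have hfac := hs.eq_prod_roots
  obtain ⟨l, hl⟩ : ∃ l : List ℂ, Q.roots = l := ⟨Q.roots.toList, by simp⟩
  have hroot : ∀ i : Fin l.length, ∃ r : ℝ, 0 < r ∧ l.get i = r := by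
    intro i
    apply hr
    have : l.get i ∈ Q.roots := by rw [hl]; simp
    exact (Polynomial.mem_roots hQne).1 this
  choose r hrpos hreq using hroot
  refine ⟨l.length, fun i => 1 / r i, fun i => one_div_pos.2 (hrpos i), ?_⟩
  apply Polynomial.map_injective Complex.ofRealHom Complex.ofRealHom.injective
  rw [← hQ]
  have e1 : Q = Polynomial.C Q.leadingCoeff * ∏ i, (Polynomial.X - Polynomial.C (r i : ℂ)) := by
    conv_lhs => rw [hfac]
    congr 1
    rw [hl, Multiset.map_coe, Multiset.prod_coe, ← List.prod_ofFn]
    congr 1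
    apply List.ext_get
    · simp
    · intro n h1 h2
      have := hreq ⟨n, by simpa using h1⟩
      simp at this
      simp [this]
  have e2 : Polynomial.C Q.leadingCoeff * ∏ i, (-Polynomial.C (r i : ℂ)) = 1 := by
    have := hQ0
    rw [e1] at this
    simp only [Polynomial.eval_mul, Polynomial.eval_C, Polynomial.eval_prod, Polynomial.eval_sub, Polynomial.eval_X, zero_sub] at this
    have h2 := congrArg Polynomial.C this
    rw [Polynomial.C_1] at h2
    rw [← h2]
    simp
  rw [Polynomial.map_prod]
  calc Q = Polynomial.C Q.leadingCoeff * ∏ i, (Polynomial.X - Polynomial.C (r i : ℂ)) := e1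
    _ = Polynomial.C Q.leadingCoeff * ∏ i, ((-Polynomial.C (r i : ℂ)) * (1 - Polynomial.C (1 / (r i : ℂ)) * Polynomial.X)) := by
        congr 1
        refine Finset.prod_congr rfl fun i _ => ?_
        have : (r i : ℂ) ≠ 0 := by exact_mod_cast (hrpos i).ne'
        have h3 : Polynomial.C (r i : ℂ) * Polynomial.C (1 / (r i : ℂ)) = 1 := by
          rw [← Polynomial.C_mul, mul_one_div_cancel this, Polynomial.C_1]
        linear_combination (-Polynomial.X : Polynomial ℂ) * h3
    _ = _ := by
        rw [Finset.prod_mul_distrib, ← mul_assoc, e2, one_mul]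
        refine Finset.prod_congr rfl fun i _ => ?_
        simp

/-- rising factorial -/
noncomputable def wpbRf (c : ℝ) (n : ℕ) : ℝ := ∏ i ∈ Finset.range n, (c + i)

/-- normalized Laguerre polynomials -/
noncomputable def wpbEll (c : ℝ) : ℕ → Polynomial ℝ
  | 0 => 1
  | N + 1 => Polynomial.C (1 / (N + c)) * (Polynomial.X * Polynomial.derivative (wpbEll c N)
      + (Polynomial.C (N + c) - Polynomial.X) * wpbEll c N)

theorem wpbRf_pos (c : ℝ) (hc : 0 < c) (n : ℕ) : 0 < wpbRf c n :=
  Finset.prod_pos fun i _ => by positivity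

theorem wpbRf_succ (c : ℝ) (n : ℕ) : wpbRf c (n + 1) = wpbRf c n * (c + n) := by
  simp [wpbRf, Finset.prod_range_succ]

theorem wpbEll_coeff (c : ℝ) (hc : 0 < c) (N n : ℕ) :
    (wpbEll c N).coeff n = (-1) ^ n * (N.choose n : ℝ) / wpbRf c n := by
  induction N generalizing n with
  | zero =>
    cases n with
    | zero => simp [wpbEll, wpbRf]
    | succ n => simp [wpbEll, Polynomial.coeff_one]
  | succ N ih =>
    have hNc : (N : ℝ) + c ≠ 0 := by positivity
    rw [wpbEll, Polynomial.coeff_C_mul, Polynomial.coeff_add, sub_mul, Polynomial.coeff_sub,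
      Polynomial.coeff_C_mul]
    cases n with
    | zero =>
      simp only [Polynomial.coeff_X_mul_zero, ih]
      field_simp
      simp
    | succ n =>
      simp only [Polynomial.coeff_X_mul, Polynomial.coeff_derivative, ih, wpbRf_succ]
      have h1 := (wpbRf_pos c hc n).ne'
      have h2 : c + n ≠ 0 := by positivity
      have h3 : ((N.choose (n + 1) : ℕ) : ℝ) * (n + 1) = N.choose n * (N - n) := by
        rcases le_or_gt n N with h | h
        · have := Nat.choose_succ_right_eq N n
          have h4 : ((N.choose (n + 1) * (n + 1) : ℕ) : ℝ) = ((N.choose n * (N - n) : ℕ) : ℝ) := by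
            rw [this]
          push_cast [Nat.cast_sub h] at h4
          exact h4
        · simp [Nat.choose_eq_zero_of_lt h, Nat.choose_eq_zero_of_lt (Nat.lt_succ_of_lt h)]
      rw [Nat.choose_succ_succ' N n]
      push_cast
      field_simp
      rw [pow_succ]
      linear_combination (-1) ^ n * (-1) * h3

theorem wpbEll_factor (c : ℝ) (hc : 0 < c) (N : ℕ) :
    ∃ (k : ℕ) (t : Fin k → ℝ), (∀ i, 0 < t i) ∧
      wpbEll c N = ∏ i, (1 - Polynomial.C (t i) * Polynomial.X) := by
  induction N with
  | zero => exact ⟨0, fun _ => 1, by simp, by simp [wpbEll]⟩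
  | succ N ih =>
    obtain ⟨k, t, ht, he⟩ := ih
    have hNc : 0 < (N : ℝ) + c := by positivity
    apply wpb_factor
    · rw [← Polynomial.coeff_zero_eq_eval_zero, wpbEll_coeff c hc]; simp [wpbRf]
    · intro z hz
      apply wpb_root_step t ht (N + c) hNc z
      rw [wpbEll, he] at hz
      have hm : (∏ i, (1 - Polynomial.C (t i) * Polynomial.X)).map Complex.ofRealHom
          = ∏ i, (1 - Polynomial.C (t i : ℂ) * Polynomial.X) := by
        rw [Polynomial.map_prod]; exact Finset.prod_congr rfl fun i _ => by simp
      rw [Polynomial.map_mul, Polynomial.map_add, Polynomial.map_mul, Polynomial.map_mul, 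
        ← Polynomial.derivative_map, hm] at hz
      simp only [Polynomial.eval_mul, Polynomial.eval_add, Polynomial.map_X, Polynomial.eval_X,
        Polynomial.map_sub, Polynomial.eval_sub, Polynomial.map_C, Polynomial.eval_C] at hz
      have : Complex.ofRealHom (1 / (N + c)) ≠ 0 := by
        simpa using (by exact_mod_cast hNc.ne' : (N : ℂ) + c ≠ 0)
      exact (mul_eq_zero.1 hz).resolve_left this

theorem wpb_newton {ι : Type*} (S : Finset ι) (t : ι → ℝ) :
    (∏ i ∈ S, (1 - Polynomial.C (t i) * Polynomial.X)).coeff 0 = 1 ∧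
    (∏ i ∈ S, (1 - Polynomial.C (t i) * Polynomial.X)).coeff 1 = - ∑ i ∈ S, t i ∧
    2 * (∏ i ∈ S, (1 - Polynomial.C (t i) * Polynomial.X)).coeff 2 =
      (∑ i ∈ S, t i) ^ 2 - ∑ i ∈ S, t i ^ 2 ∧
    6 * (∏ i ∈ S, (1 - Polynomial.C (t i) * Polynomial.X)).coeff 3 =
      -((∑ i ∈ S, t i) ^ 3 - 3 * (∑ i ∈ S, t i) * (∑ i ∈ S, t i ^ 2) + 2 * ∑ i ∈ S, t i ^ 3) := by
  classical
  induction S using Finset.induction_on with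
  | empty => simp [Polynomial.coeff_one]
  | insert a S ha ih =>
    obtain ⟨h0, h1, h2, h3⟩ := ih
    simp only [Finset.prod_insert ha, Finset.sum_insert ha, sub_mul, one_mul, mul_assoc,
      Polynomial.coeff_sub, Polynomial.coeff_C_mul, Polynomial.coeff_X_mul, Polynomial.coeff_X_mul_zero]
    refine ⟨by linarith, ?_, ?_, ?_⟩
    · linear_combination h1 - t a * h0
    · linear_combination h2 - 2 * t a * h1
    · linear_combination h3 - 3 * t a * h2


/-- Taylor coefficients of the normalized Bessel function in `s = x²`. -/
noncomputable def wpbA (c : ℝ) (n : ℕ) : ℝ := (-1 / 4) ^ n / (n.factorial * wpbRf c n)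

theorem wpbA_succ (c : ℝ) (hc : 0 < c) (n : ℕ) :
    (n + 1) * (c + n) * wpbA c (n + 1) = - wpbA c n / 4 := by
  have h1 := (wpbRf_pos c hc n).ne'
  have h2 : c + n ≠ 0 := by positivity
  rw [wpbA, wpbA, wpbRf_succ, Nat.factorial_succ]
  push_cast
  field_simp
  ring

/-- coefficients of the cross product in `z = x⁴`. -/
noncomputable def wpbB (c : ℝ) (k : ℕ) : ℝ :=
  (-1 / 16) ^ k / (k.factorial * wpbRf c k * wpbRf (c + 1) (2 * k))

theorem wpbB_succ (c : ℝ) (hc : 0 < c) (k : ℕ) :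
    16 * (k + 1) * (c + k) * ((c + 2 * k + 1) * (c + 2 * k + 2)) * wpbB c (k + 1) = - wpbB c k := by
  have h1 := (wpbRf_pos c hc k).ne'
  have h2 : c + k ≠ 0 := by positivity
  have h3 := (wpbRf_pos (c + 1) (by linarith) (2 * k)).ne'
  have h4 : c + 2 * k + 1 ≠ 0 := by positivity
  have h5 : c + 2 * k + 2 ≠ 0 := by positivity
  have e : wpbRf (c + 1) (2 * (k + 1)) = wpbRf (c + 1) (2 * k) * (c + 2 * k + 1) * (c + 2 * k + 2) := by
    rw [show 2 * (k + 1) = 2 * k + 1 + 1 by ring, wpbRf_succ, wpbRf_succ]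
    push_cast; ring
  rw [wpbB, wpbB, wpbRf_succ, Nat.factorial_succ, e]
  push_cast
  field_simp
  ring

open PowerSeries in
theorem wpb_formal (c : ℝ) (hc : 0 < c) :
    let J : PowerSeries ℝ := PowerSeries.mk (wpbA c)
    let K : PowerSeries ℝ := PowerSeries.mk (fun n => (-1) ^ n * wpbA c n)
    let D : PowerSeries ℝ := PowerSeries.mk (fun n => (2 * n + 1) * wpbA c n)
    let M : PowerSeries ℝ := PowerSeries.mk (fun n => (-1) ^ n * ((2 * n + 1) * wpbA c n))
    ∀ k : ℕ, PowerSeries.coeff (2 * k) (D * K - M * J) = 0 ∧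
      PowerSeries.coeff (2 * k + 1) (D * K - M * J) = - wpbB c k / c := by
  intro J K D M
  let d := fun f : PowerSeries ℝ => PowerSeries.derivative ℝ f
  have dmul : ∀ f g, d (f * g) = d f * g + f * d g := by
    intro f g
    change PowerSeries.derivative ℝ (f * g) = _
    rw [Derivation.leibniz]; simp only [smul_eq_mul]; change _ = _ ; simp only [d]; ring
  have dcoeff : ∀ f n, PowerSeries.coeff n (d f) = PowerSeries.coeff (n + 1) f * (n + 1) := by
    intro f n; exact PowerSeries.coeff_derivative f n
  have dsub : ∀ f g, d (f - g) = d f - d g := fun f g => map_sub _ f g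
  have dadd : ∀ f g, d (f + g) = d f + d g := fun f g => map_add _ f g
  -- coefficient of X * d f
  have Xd : ∀ f n, PowerSeries.coeff n (PowerSeries.X * d f) = n * PowerSeries.coeff n f := by
    intro f n
    cases n with
    | zero => simp
    | succ n => rw [PowerSeries.coeff_succ_X_mul, dcoeff]; push_cast; ring
  have hD : D = J + C 2 * (PowerSeries.X * d J) := by
    ext n
    simp only [map_add, PowerSeries.coeff_C_mul, Xd]
    simp only [D, J, PowerSeries.coeff_mk]; ring
  have hM : M = K + C 2 * (PowerSeries.X * d K) := by
    ext n
    simp only [map_add, PowerSeries.coeff_C_mul, Xd]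
    simp only [M, K, PowerSeries.coeff_mk]; ring
  have odeJ : PowerSeries.X * d (d J) = - (C c * d J) - C (1/4) * J := by
    ext n
    rw [Xd]
    simp only [map_sub, map_neg, PowerSeries.coeff_C_mul, dcoeff]
    simp only [J, PowerSeries.coeff_mk]
    linear_combination wpbA_succ c hc n
  have odeK : PowerSeries.X * d (d K) = - (C c * d K) + C (1/4) * K := by
    ext n
    rw [Xd]
    simp only [map_add, map_neg, PowerSeries.coeff_C_mul, dcoeff]
    simp only [K, PowerSeries.coeff_mk]
    linear_combination (-1) ^ (n + 1) * wpbA_succ c hc n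
  set W := d J * K - d K * J with hW
  set P := J * K with hP
  set V := d J * K + J * d K with hV
  set Q := d J * d K with hQ
  have eP : d P = V := dmul _ _
  have C24 : (C (1/2 : ℝ) : PowerSeries ℝ) = 2 * C (1/4 : ℝ) := by
    rw [← map_ofNat (C : ℝ →+* PowerSeries ℝ) 2, ← map_mul]; norm_num
  have eW : PowerSeries.X * d W = - (C c * W) - C (1/2) * P := by
    rw [hW, dsub, dmul, dmul, hP, C24]
    linear_combination K * odeJ - J * odeK
  have eV : PowerSeries.X * d V = - (C c * V) + PowerSeries.X * (C 2 * Q) := by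
    rw [hV, dadd, dmul, dmul, hQ]
    have : (C (2 : ℝ) : PowerSeries ℝ) = 2 := map_ofNat _ 2
    rw [this]
    linear_combination K * odeJ + J * odeK
  have eQ : PowerSeries.X * d Q = - (C (2 * c) * Q) + C (1/4) * W := by
    have : (C (2 * c : ℝ) : PowerSeries ℝ) = 2 * C c := by rw [map_mul, map_ofNat]
    rw [hQ, dmul, hW, this]
    linear_combination (d K) * odeJ + (d J) * odeK
  have cW : ∀ n : ℕ, (n + c) * coeff n W = - coeff n P / 2 := by
    intro n
    have := congrArg (coeff n) eW
    rw [Xd] at this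
    simp only [map_sub, map_neg, PowerSeries.coeff_C_mul] at this
    linarith
  have cV : ∀ n : ℕ, (n + 1 + c) * coeff (n + 1) V = 2 * coeff n Q := by
    intro n
    have := congrArg (coeff (n + 1)) eV
    rw [Xd] at this
    simp only [map_add, map_neg, PowerSeries.coeff_C_mul, PowerSeries.coeff_succ_X_mul] at this
    push_cast at this
    linarith
  have cV0 : coeff 0 V = 0 := by
    have := congrArg (coeff 0) eV
    rw [Xd] at this
    simp only [map_add, map_neg, PowerSeries.coeff_C_mul, PowerSeries.coeff_zero_X_mul] at this
    have h : c * coeff 0 V = 0 := by push_cast at this; linarith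
    exact (mul_eq_zero.1 h).resolve_left hc.ne'
  have cQ : ∀ n : ℕ, (n + 2 * c) * coeff n Q = coeff n W / 4 := by
    intro n
    have := congrArg (coeff n) eQ
    rw [Xd] at this
    simp only [map_add, map_neg, PowerSeries.coeff_C_mul] at this
    linarith
  have cP : ∀ n : ℕ, coeff (n + 1) P * (n + 1) = coeff n V := by
    intro n; rw [← eP, dcoeff]
  have rec1 : ∀ n : ℕ, (n + 2 + c) * ((n + 2) * (n + 1 + c) * (n + 2 * c)) * coeff (n + 2) W
      = - coeff n W / 4 := by
    intro n
    have a1 := cW (n + 2)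
    have a2 := cP (n + 1)
    have a3 := cV n
    have a4 := cQ n
    push_cast at a1 a2
    rw [show n + 1 + 1 = n + 2 by ring] at a2
    linear_combination ((n + 2) * (n + 1 + c) * (n + 2 * c)) * a1 - (n + 1 + c) * (n + 2 * c) / 2 * a2
      - (n + 2 * c) / 2 * a3 - a4
  have P0 : coeff 0 P = 1 := by
    rw [hP]
    simp [PowerSeries.coeff_mul, J, K, wpbA, wpbRf]
  have W0 : coeff 0 W = - 1 / (2 * c) := by
    have := cW 0
    rw [P0] at this
    push_cast at this
    field_simp
    linarith
  have W1 : coeff 1 W = 0 := by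
    have := cW 1
    have h2 := cP 0
    rw [cV0] at h2
    have h3 : coeff 1 P = 0 := by simpa using h2
    rw [h3] at this
    push_cast at this
    have : (1 + c) * coeff 1 W = 0 := by linarith
    exact (mul_eq_zero.1 this).resolve_left (by positivity)
  have hall : ∀ k : ℕ, coeff (2 * k) W = - wpbB c k / (2 * c) ∧ coeff (2 * k + 1) W = 0 := by
    intro k
    induction k with
    | zero => simpa [wpbB, wpbRf, W1] using W0
    | succ k ih =>
      have r1 := rec1 (2 * k)
      have r2 := rec1 (2 * k + 1)
      rw [ih.1] at r1
      rw [ih.2] at r2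
      push_cast at r1 r2
      constructor
      · have hB := wpbB_succ c hc k
        rw [show 2 * (k + 1) = 2 * k + 2 by ring]
        have hne : (2 * (k : ℝ) + 2 + c) * ((2 * k + 2) * (2 * k + 1 + c) * (2 * k + 2 * c)) ≠ 0 := by
          positivity
        apply mul_left_cancel₀ hne
        rw [r1]
        field_simp
        linear_combination hB
      · rw [show 2 * (k + 1) + 1 = 2 * k + 1 + 2 by ring]
        have hne : (2 * (k : ℝ) + 1 + 2 + c) * ((2 * k + 1 + 2) * (2 * k + 1 + 1 + c) * (2 * k + 1 + 2 * c)) ≠ 0 := by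
          positivity
        apply mul_left_cancel₀ hne
        rw [r2]; simp
  have hU : D * K - M * J = PowerSeries.X * (C 2 * W) := by
    rw [hD, hM, hW]; ring
  intro k
  rw [hU]
  constructor
  · cases k with
    | zero => simp
    | succ k =>
      rw [show 2 * (k + 1) = 2 * k + 1 + 1 by ring, PowerSeries.coeff_succ_X_mul,
        PowerSeries.coeff_C_mul, (hall k).2, mul_zero]
  · rw [PowerSeries.coeff_succ_X_mul, PowerSeries.coeff_C_mul, (hall k).1]
    field_simp



theorem wpbRf_ge (c : ℝ) (hc : 0 < c) (n : ℕ) : min c 1 ≤ wpbRf c n := by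
  have h0 : 0 < min c 1 := lt_min hc one_pos
  cases n with
  | zero => simp [wpbRf]
  | succ n =>
    induction n with
    | zero => simp [wpbRf]
    | succ n ih =>
      rw [wpbRf_succ]
      have h1 : 1 ≤ c + ((n + 1 : ℕ) : ℝ) := by push_cast; have : (0:ℝ) ≤ n := n.cast_nonneg; linarith
      have := wpbRf_pos c hc (n + 1)
      nlinarith

theorem wpbA_summable_D (c : ℝ) (hc : 0 < c) (r : ℝ) (hr : 0 ≤ r) :
    Summable (fun n : ℕ => (2 * n + 1) * |wpbA c n| * r ^ n) := by
  have h0 : 0 < min c 1 := lt_min hc one_pos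
  refine Summable.of_nonneg_of_le (fun n => by positivity) (fun n => ?_)
    ((Real.summable_pow_div_factorial (3 / 4 * r)).mul_left (1 / min c 1))
  have hA : |wpbA c n| ≤ (1 / 4) ^ n / (n.factorial * min c 1) := by
    have hp := wpbRf_pos c hc n
    rw [wpbA, abs_div, abs_pow, abs_of_pos (by positivity : (0:ℝ) < n.factorial * wpbRf c n)]
    rw [show |(-1 / 4 : ℝ)| = 1 / 4 by rw [abs_of_neg] <;> norm_num]
    have := wpbRf_ge c hc n
    gcongr
  have h3 : (2 * (n : ℝ) + 1) ≤ 3 ^ n := by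
    have := one_add_mul_le_pow (show (-2 : ℝ) ≤ 2 by norm_num) n
    norm_num at this
    linarith
  calc (2 * (n : ℝ) + 1) * |wpbA c n| * r ^ n
      ≤ 3 ^ n * ((1 / 4) ^ n / (n.factorial * min c 1)) * r ^ n := by gcongr
    _ = 1 / min c 1 * ((3 / 4 * r) ^ n / n.factorial) := by
      rw [mul_pow, div_pow, div_pow, one_pow]; field_simp

theorem wpbA_summable (c : ℝ) (hc : 0 < c) (r : ℝ) (hr : 0 ≤ r) :
    Summable (fun n : ℕ => |wpbA c n| * r ^ n) := by
  refine Summable.of_nonneg_of_le (fun n => by positivity) (fun n => ?_) (wpbA_summable_D c hc r hr)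
  have : (0:ℝ) ≤ n := n.cast_nonneg
  have h1 : |wpbA c n| ≤ (2 * n + 1) * |wpbA c n| := by nlinarith [abs_nonneg (wpbA c n)]
  gcongr

theorem wpb_cont (a : ℕ → ℝ) (ha : ∀ r : ℝ, 0 ≤ r → Summable (fun n => |a n| * r ^ n)) :
    Continuous (fun s : ℝ => ∑' n, a n * s ^ n) := by
  rw [continuous_iff_continuousAt]
  intro x
  have : ContinuousOn (fun s : ℝ => ∑' n, a n * s ^ n) (Icc (-(|x| + 1)) (|x| + 1)) := by
    refine continuousOn_tsum (fun n => by fun_prop) (ha (|x| + 1) (by positivity)) ?_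
    intro n y hy
    rw [norm_mul, norm_pow, Real.norm_eq_abs, Real.norm_eq_abs]
    have : |y| ≤ |x| + 1 := abs_le.2 hy
    gcongr
  apply this.continuousAt
  apply Icc_mem_nhds <;> cases abs_cases x <;> linarith

/-- `𝒥_ν` as function of `s = x²`. -/
noncomputable def wpbJ (c s : ℝ) : ℝ := ∑' n, wpbA c n * s ^ n
/-- `𝒟_ν` as function of `s = x²`. -/
noncomputable def wpbD (c s : ℝ) : ℝ := ∑' n : ℕ, (2 * n + 1) * wpbA c n * s ^ n

theorem wpbJ_cont (c : ℝ) (hc : 0 < c) : Continuous (wpbJ c) :=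
  wpb_cont _ (wpbA_summable c hc)

theorem wpbD_abs (c : ℝ) (n : ℕ) : |(2 * (n:ℝ) + 1) * wpbA c n| = (2 * n + 1) * |wpbA c n| := by
  rw [abs_mul, abs_of_nonneg (by positivity)]

theorem wpbD_cont (c : ℝ) (hc : 0 < c) : Continuous (wpbD c) := by
  apply wpb_cont (fun n : ℕ => (2 * n + 1) * wpbA c n)
  intro r hr
  simpa only [wpbD_abs] using wpbA_summable_D c hc r hr

theorem wpbJ_zero (c : ℝ) : wpbJ c 0 = 1 := by
  rw [wpbJ, tsum_eq_single 0]
  · simp [wpbA, wpbRf]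
  · intro n hn; simp [hn]

theorem wpbD_zero (c : ℝ) : wpbD c 0 = 1 := by
  rw [wpbD, tsum_eq_single 0]
  · simp [wpbA, wpbRf]
  · intro n hn; simp [hn]

theorem wpb_cross (c : ℝ) (hc : 0 < c) (s : ℝ) :
    HasSum (fun k => wpbB c k * s ^ (2 * k) * s)
      (-c * (wpbD c s * wpbJ c (-s) - wpbD c (-s) * wpbJ c s)) := by
  have hJ : ∀ y : ℝ, Summable (fun n => ‖wpbA c n * y ^ n‖) := fun y => by
    simpa only [norm_mul, norm_pow, Real.norm_eq_abs] using wpbA_summable c hc |y| (abs_nonneg y)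
  have hD : ∀ y : ℝ, Summable (fun n : ℕ => ‖(2 * n + 1) * wpbA c n * y ^ n‖) := fun y => by
    have := wpbA_summable_D c hc |y| (abs_nonneg y)
    refine this.congr fun n => ?_
    rw [norm_mul, norm_pow, Real.norm_eq_abs, Real.norm_eq_abs, wpbD_abs]
  have h1 := (summable_norm_sum_mul_antidiagonal_of_summable_norm (hD s) (hJ (-s))).of_norm.hasSum
  have h2 := (summable_norm_sum_mul_antidiagonal_of_summable_norm (hD (-s)) (hJ s)).of_norm.hasSum
  rw [← tsum_mul_tsum_eq_tsum_sum_antidiagonal_of_summable_norm (hD s) (hJ (-s))] at h1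
  rw [← tsum_mul_tsum_eq_tsum_sum_antidiagonal_of_summable_norm (hD (-s)) (hJ s)] at h2
  have h3 := ((h1.sub h2).mul_left (-c))
  have hf := wpb_formal c hc
  dsimp only at hf
  set U : PowerSeries ℝ := PowerSeries.mk (fun n : ℕ => (2 * n + 1) * wpbA c n) * PowerSeries.mk (fun n => (-1) ^ n * wpbA c n)
    - PowerSeries.mk (fun n : ℕ => (-1) ^ n * ((2 * n + 1) * wpbA c n)) * PowerSeries.mk (wpbA c) with hU
  have h4 : ∀ n, PowerSeries.coeff n U * s ^ n =
      ∑ kl ∈ Finset.HasAntidiagonal.antidiagonal n, (2 * (kl.1 : ℝ) + 1) * wpbA c kl.1 * s ^ kl.1 * (wpbA c kl.2 * (-s) ^ kl.2)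
       - ∑ kl ∈ Finset.HasAntidiagonal.antidiagonal n, (2 * (kl.1 : ℝ) + 1) * wpbA c kl.1 * (-s) ^ kl.1 * (wpbA c kl.2 * s ^ kl.2) := by
    intro n
    rw [hU, map_sub, PowerSeries.coeff_mul, PowerSeries.coeff_mul, sub_mul, Finset.sum_mul, Finset.sum_mul]
    congr 1
    · refine Finset.sum_congr rfl fun x hx => ?_
      rw [← Finset.HasAntidiagonal.mem_antidiagonal.1 hx, neg_pow s, pow_add]
      simp only [PowerSeries.coeff_mk]; ring
    · refine Finset.sum_congr rfl fun x hx => ?_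
      rw [← Finset.HasAntidiagonal.mem_antidiagonal.1 hx, neg_pow s, pow_add]
      simp only [PowerSeries.coeff_mk]; ring
  have h5 : HasSum (fun n => -c * (PowerSeries.coeff n U * s ^ n))
      (-c * (wpbD c s * wpbJ c (-s) - wpbD c (-s) * wpbJ c s)) := by
    simp only [h4]; exact h3
  have hinj : Function.Injective (fun k : ℕ => 2 * k + 1) := fun a b h => by simpa using h
  rw [← hinj.hasSum_iff] at h5
  · convert h5 using 1
    funext k
    simp only [Function.comp]
    rw [(hf k).2, pow_succ]
    field_simp
  · intro n hn
    rcases Nat.even_or_odd' n with ⟨k, rfl | rfl⟩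
    · rw [(hf k).1]; simp
    · exact absurd ⟨k, rfl⟩ hn

theorem wpb_choose_tendsto (n : ℕ) :
    Tendsto (fun N : ℕ => (N.choose n : ℝ) * (1 / (N : ℝ)) ^ n) atTop (𝓝 (1 / n.factorial)) := by
  induction n with
  | zero => simp
  | succ n ih =>
    have h1 : Tendsto (fun N : ℕ => (1 - (n : ℝ) * (1 / (N : ℝ))) * (1 / ((n : ℝ) + 1))) atTop (𝓝 (1 / (n + 1))) := by
      have := ((tendsto_one_div_atTop_nhds_zero_nat (𝕜 := ℝ)).const_mul (n : ℝ)).const_sub 1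
      simpa using this.mul_const (1 / ((n : ℝ) + 1))
    have h2 := ih.mul h1
    have e : (1 : ℝ) / n.factorial * (1 / (n + 1)) = 1 / (n + 1).factorial := by
      rw [Nat.factorial_succ]; push_cast; field_simp
    rw [e] at h2
    refine h2.congr' ?_
    filter_upwards [eventually_ge_atTop (n + 1)] with N hN
    have hN0 : (N : ℝ) ≠ 0 := by
      have : 0 < N := by omega
      exact_mod_cast this.ne'
    have h3 : ((N.choose (n + 1) : ℕ) : ℝ) * (n + 1) = N.choose n * (N - n) := by
      have := Nat.choose_succ_right_eq N n
      have h4 : ((N.choose (n + 1) * (n + 1) : ℕ) : ℝ) = ((N.choose n * (N - n) : ℕ) : ℝ) := by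
        rw [this]
      push_cast [Nat.cast_sub (by omega : n ≤ N)] at h4
      exact h4
    have h5 : ((N.choose (n + 1) : ℕ) : ℝ) = N.choose n * (N - n) / (n + 1) := by
      field_simp; exact h3
    rw [h5, pow_succ]
    field_simp

/-- Approximating polynomials with only positive roots. -/
theorem wpb_approx (c : ℝ) (hc : 0 < c) : ∃ q : ℕ → Polynomial ℝ,
    (∀ N, ∃ (k : ℕ) (t : Fin k → ℝ), (∀ i, 0 ≤ t i) ∧
      q N = ∏ i, (1 - Polynomial.C (t i) * Polynomial.X)) ∧
    (∀ N n, |(q N).coeff n| ≤ |wpbA c n|) ∧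
    (∀ n, Tendsto (fun N => (q N).coeff n) atTop (𝓝 (wpbA c n))) := by
  have hco : ∀ N n : ℕ, ((wpbEll c N).comp (Polynomial.C (1 / 4 * (1 / (N : ℝ))) * Polynomial.X)).coeff n
      = (-1 / 4) ^ n / wpbRf c n * (N.choose n * (1 / (N : ℝ)) ^ n) := by
    intro N n
    rw [Polynomial.comp_C_mul_X_coeff, wpbEll_coeff c hc, mul_pow,
      show (-1 / 4 : ℝ) = (-1) * (1 / 4) by norm_num, mul_pow (-1 : ℝ)]
    ring
  refine ⟨fun N => (wpbEll c N).comp (Polynomial.C (1 / 4 * (1 / (N : ℝ))) * Polynomial.X), ?_, ?_, ?_⟩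
  · intro N
    obtain ⟨k, t, ht, he⟩ := wpbEll_factor c hc N
    refine ⟨k, fun i => t i * (1 / 4 * (1 / (N : ℝ))), fun i => by have := (ht i).le; positivity, ?_⟩
    dsimp only
    rw [he, Polynomial.prod_comp]
    refine Finset.prod_congr rfl fun i _ => ?_
    simp [mul_assoc]
  · intro N n
    have hp := wpbRf_pos c hc n
    dsimp only
    rw [hco, wpbA, abs_mul, abs_div, abs_div, abs_of_pos hp,
      abs_of_pos (by positivity : (0:ℝ) < n.factorial * wpbRf c n),
      abs_of_nonneg (by positivity : 0 ≤ (N.choose n : ℝ) * (1 / (N : ℝ)) ^ n)]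
    have h1 : (N.choose n : ℝ) * (1 / (N : ℝ)) ^ n ≤ 1 / n.factorial := by
      have h2 : (N.choose n : ℝ) ≤ N ^ n / n.factorial := Nat.choose_le_pow_div n N
      calc (N.choose n : ℝ) * (1 / (N : ℝ)) ^ n ≤ N ^ n / n.factorial * (1 / (N : ℝ)) ^ n := by gcongr
        _ = (N * (1 / (N : ℝ))) ^ n / n.factorial := by rw [mul_pow]; ring
        _ ≤ 1 / n.factorial := by
          gcongr
          apply pow_le_one₀ (by positivity)
          rw [mul_one_div]; exact div_self_le_one _
    calc _ ≤ |(-1 / 4 : ℝ) ^ n| / wpbRf c n * (1 / n.factorial) := by gcongr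
      _ = _ := by field_simp
  · intro n
    simp only [hco]
    have := (wpb_choose_tendsto n).const_mul ((-1 / 4) ^ n / wpbRf c n)
    convert this using 2
    rw [wpbA]
    have := (wpbRf_pos c hc n).ne'
    field_simp

theorem wpb_eval_tsum (q : Polynomial ℝ) (s : ℝ) : q.eval s = ∑' n, q.coeff n * s ^ n := by
  rw [Polynomial.eval_eq_sum_range, tsum_eq_sum]
  intro n hn
  rw [Polynomial.coeff_eq_zero_of_natDegree_lt (by simpa using hn), zero_mul]

theorem wpb_evalD_tsum (q : Polynomial ℝ) (s : ℝ) :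
    q.eval s + 2 * s * (Polynomial.derivative q).eval s = ∑' n : ℕ, (2 * n + 1) * q.coeff n * s ^ n := by
  have : q.eval s + 2 * s * (Polynomial.derivative q).eval s
     = (q + Polynomial.C 2 * (Polynomial.X * Polynomial.derivative q)).eval s := by
    simp [mul_assoc]
  rw [this, wpb_eval_tsum]
  refine tsum_congr fun n => ?_
  congr 1
  rw [Polynomial.coeff_add, Polynomial.coeff_C_mul]
  cases n with
  | zero => simp
  | succ n => rw [Polynomial.coeff_X_mul, Polynomial.coeff_derivative]; push_cast; ring


set_option maxHeartbeats 1000000 in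
theorem wpb_pkg {k : ℕ} (t : Fin k → ℝ) (ht : ∀ i, 0 ≤ t i) (q : Polynomial ℝ)
    (hq : q = ∏ i, (1 - Polynomial.C (t i) * Polynomial.X)) (s ρ : ℝ) (hs : 0 < s) (hsρ : s < ρ)
    (htρ : ∀ i, t i * ρ < 1) (p pm d dm dr g0 g1 g2 : ℝ) (hp : p = q.eval s)
    (hpm : pm = q.eval (-s))
    (hd : d = q.eval s + 2 * s * (Polynomial.derivative q).eval s)
    (hdm : dm = q.eval (-s) + 2 * (-s) * (Polynomial.derivative q).eval (-s))
    (hdr : dr = q.eval ρ + 2 * ρ * (Polynomial.derivative q).eval ρ)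
    (hg0 : g0 = - q.coeff 1) (hg1 : g1 = q.coeff 1 ^ 2 - 2 * q.coeff 2)
    (hg2 : g2 = - q.coeff 1 ^ 3 + 3 * q.coeff 1 * q.coeff 2 - 3 * q.coeff 3) :
    2 * s * (2 * g0 + 2 * s ^ 2 * g2) * (p * pm) ≤ dm * p - d * pm ∧
    (ρ ^ 2 - s ^ 2) * (dm * p - d * pm) ≤
      2 * s * (2 * ρ ^ 2 * g0 - 2 * s ^ 2 * (g0 - ρ ^ 2 * g2)) * (p * pm) ∧
    d * dm ≤ p * pm ∧
    (0 ≤ dr → (ρ ^ 2 - s ^ 2) * (dm * p - d * pm + 8 * ρ * s ^ 3 * (g0 * g2 - g1 ^ 2) * (p * pm)) ≤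
      2 * s * ρ ^ 2 * (2 * g0) * (d * dm)) ∧
    ρ * g1 ≤ g0 ∧ ρ * g2 ≤ g1 ∧ d ≤ p := by
  obtain ⟨-, n1, n2, n3⟩ := wpb_newton Finset.univ t
  rw [← hq] at n1 n2 n3
  have e0 : g0 = ∑ i, t i := by rw [hg0, n1]; ring
  have e1 : g1 = ∑ i, t i ^ 2 := by
    rw [hg1, n1]; linarith
  have e2 : g2 = ∑ i, t i ^ 3 := by
    have h2 : q.coeff 2 = ((∑ i, t i) ^ 2 - ∑ i, t i ^ 2) / 2 := by linarith
    have h3 : q.coeff 3 = -((∑ i, t i) ^ 3 - 3 * (∑ i, t i) * (∑ i, t i ^ 2) + 2 * ∑ i, t i ^ 3) / 6 := by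
      linarith
    rw [hg2, n1, h2, h3]; ring
  have hts : ∀ i, t i * s < 1 := fun i => lt_of_le_of_lt (mul_le_mul_of_nonneg_left hsρ.le (ht i)) (htρ i)
  have hρ : 0 < ρ := hs.trans hsρ
  have hA : ∀ i, 0 < 1 - t i * s := fun i => sub_pos.2 (hts i)
  have hB : ∀ i, 0 < 1 - t i * ρ := fun i => sub_pos.2 (htρ i)
  have hC : ∀ i, 0 < 1 - t i * (-s) := fun i => by have := mul_nonneg (ht i) hs.le; linarith
  have hC' : ∀ i, 0 < 1 + t i * s := fun i => by have := mul_nonneg (ht i) hs.le; linarith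
  have p0 : 0 < p := by rw [hp, hq, wpb_eval_prod]; exact Finset.prod_pos fun i _ => hA i
  have pm0 : 0 < pm := by rw [hpm, hq, wpb_eval_prod]; exact Finset.prod_pos fun i _ => hC i
  have pr0 : 0 < q.eval ρ := by rw [hq, wpb_eval_prod]; exact Finset.prod_pos fun i _ => hB i
  set G := ∑ i, t i / (1 - t i * s) with hG
  set H := ∑ i, t i / (1 + t i * s) with hH
  have ed : d = p * (1 - 2 * s * G) := by
    rw [hd, hq, wpb_eval_deriv _ _ _ (fun i _ => (hA i).ne'), ← wpb_eval_prod, ← hq, ← hp]; ring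
  have edm : dm = pm * (1 + 2 * s * H) := by
    rw [hdm, hq, wpb_eval_deriv _ _ _ (fun i _ => (hC i).ne'), ← wpb_eval_prod, ← hq, ← hpm, hH]
    simp only [mul_neg, sub_neg_eq_add]; ring
  have edr : dr = q.eval ρ * (1 - 2 * ρ * ∑ i, t i / (1 - t i * ρ)) := by
    rw [hdr, hq, wpb_eval_deriv _ _ _ (fun i _ => (hB i).ne'), ← wpb_eval_prod]; ring
  have G0 : 0 ≤ G := Finset.sum_nonneg fun i _ => div_nonneg (ht i) (hA i).le
  have H0 : 0 ≤ H := Finset.sum_nonneg fun i _ => div_nonneg (ht i) (hC' i).le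
  have HG : H ≤ G := Finset.sum_le_sum fun i _ =>
    div_le_div_of_nonneg_left (ht i) (hA i) (by have := mul_nonneg (ht i) hs.le; linarith)
  have P0 : 0 < p * pm := mul_pos p0 pm0
  have eS : dm * p - d * pm = 2 * s * (G + H) * (p * pm) := by rw [ed, edm]; ring
  have eE : d * dm = (1 - 2 * s * G) * (1 + 2 * s * H) * (p * pm) := by rw [ed, edm]; ring
  have f1 := wpb_fin_low t s hs ht hts
  have f2 := wpb_fin_up t s ρ hs hsρ ht htρ
  rw [← e0, ← e2] at f1 f2
  rw [← hG, ← hH] at f1 f2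
  refine ⟨?_, ?_, ?_, ?_, ?_, ?_, ?_⟩
  · rw [eS]; gcongr
  · rw [eS]
    calc _ = 2 * s * ((ρ ^ 2 - s ^ 2) * (G + H)) * (p * pm) := by ring
      _ ≤ _ := by gcongr
  · rw [eE]
    have : (1 - 2 * s * G) * (1 + 2 * s * H) ≤ 1 := by
      nlinarith [mul_nonneg hs.le (sub_nonneg.2 HG), mul_nonneg (mul_nonneg hs.le G0) (mul_nonneg hs.le H0)]
    exact mul_le_of_le_one_left P0.le this
  · intro h
    have hδ : 0 ≤ 1 - 2 * ρ * ∑ i, t i / (1 - t i * ρ) := by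
      rw [edr] at h
      exact nonneg_of_mul_nonneg_right h pr0
    have f3 := wpb_fin_dini t s ρ hs hsρ ht htρ hδ
    rw [← e0, ← e1, ← e2, ← hG, ← hH] at f3
    rw [eS, eE]
    calc _ = 2 * s * ((ρ ^ 2 - s ^ 2) * (G + H + 4 * ρ * s ^ 2 * (g0 * g2 - g1 ^ 2))) * (p * pm) := by ring
      _ ≤ 2 * s * (ρ ^ 2 * (2 * g0) * ((1 - 2 * s * G) * (1 + 2 * s * H))) * (p * pm) := by gcongr
      _ = _ := by ring
  · rw [e0, e1, Finset.mul_sum]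
    refine Finset.sum_le_sum fun i _ => ?_
    have := mul_nonneg (ht i) (hB i).le
    clear_value G H
    linear_combination this
  · rw [e1, e2, Finset.mul_sum]
    refine Finset.sum_le_sum fun i _ => ?_
    have := mul_nonneg (sq_nonneg (t i)) (hB i).le
    clear_value G H
    linear_combination this
  · rw [ed]
    have := mul_nonneg p0.le (mul_nonneg hs.le G0)
    linear_combination 2 * this

theorem wpb_limJ (c : ℝ) (hc : 0 < c) (q : ℕ → Polynomial ℝ)
    (h1 : ∀ N n, |(q N).coeff n| ≤ |wpbA c n|)
    (h2 : ∀ n, Tendsto (fun N => (q N).coeff n) atTop (𝓝 (wpbA c n))) (s : ℝ) :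
    Tendsto (fun N => (q N).eval s) atTop (𝓝 (wpbJ c s)) := by
  simp only [wpb_eval_tsum]
  refine tendsto_tsum_of_dominated_convergence (wpbA_summable c hc |s| (abs_nonneg s))
    (fun n => (h2 n).mul_const _) (Eventually.of_forall fun N n => ?_)
  rw [norm_mul, norm_pow, Real.norm_eq_abs, Real.norm_eq_abs]
  have := h1 N n
  gcongr

theorem wpb_limD (c : ℝ) (hc : 0 < c) (q : ℕ → Polynomial ℝ)
    (h1 : ∀ N n, |(q N).coeff n| ≤ |wpbA c n|)
    (h2 : ∀ n, Tendsto (fun N => (q N).coeff n) atTop (𝓝 (wpbA c n))) (s : ℝ) :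
    Tendsto (fun N => (q N).eval s + 2 * s * (Polynomial.derivative (q N)).eval s) atTop
      (𝓝 (wpbD c s)) := by
  simp only [wpb_evalD_tsum]
  refine tendsto_tsum_of_dominated_convergence (wpbA_summable_D c hc |s| (abs_nonneg s))
    (fun n => ((h2 n).const_mul _).mul_const _) (Eventually.of_forall fun N n => ?_)
  rw [norm_mul, norm_mul, norm_pow, Real.norm_eq_abs, Real.norm_eq_abs, Real.norm_eq_abs,
    abs_of_nonneg (by positivity : (0:ℝ) ≤ 2 * n + 1)]
  have := h1 N n
  gcongr

theorem wpb_unif (c : ℝ) (hc : 0 < c) (q : ℕ → Polynomial ℝ)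
    (h1 : ∀ N n, |(q N).coeff n| ≤ |wpbA c n|)
    (h2 : ∀ n, Tendsto (fun N => (q N).coeff n) atTop (𝓝 (wpbA c n))) (ρ : ℝ) (hρ : 0 ≤ ρ)
    (hpos : ∀ y ∈ Icc 0 ρ, 0 < wpbJ c y) :
    ∀ᶠ N in atTop, ∀ y ∈ Icc 0 ρ, 0 < (q N).eval y := by
  obtain ⟨y0, hy0, hmin⟩ := isCompact_Icc.exists_isMinOn (nonempty_Icc.2 hρ) (wpbJ_cont c hc).continuousOn
  have hm := hpos y0 hy0
  have hsum2 : Summable (fun n => 2 * (|wpbA c n| * ρ ^ n)) := (wpbA_summable c hc ρ hρ).mul_left 2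
  have hb : ∀ N n, |(q N).coeff n - wpbA c n| * ρ ^ n ≤ 2 * (|wpbA c n| * ρ ^ n) := by
    intro N n
    have : |(q N).coeff n - wpbA c n| ≤ 2 * |wpbA c n| := by
      have := abs_sub ((q N).coeff n) (wpbA c n)
      have := h1 N n
      linarith
    calc _ ≤ (2 * |wpbA c n|) * ρ ^ n := by gcongr
      _ = _ := by ring
  have hlim : Tendsto (fun N => ∑' n, |(q N).coeff n - wpbA c n| * ρ ^ n) atTop (𝓝 (∑' n : ℕ, (0:ℝ))) := by
    refine tendsto_tsum_of_dominated_convergence hsum2 (fun n => ?_) (Eventually.of_forall fun N n => ?_)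
    · have := (((h2 n).sub_const (wpbA c n)).abs).mul_const (ρ ^ n)
      simpa using this
    · rw [Real.norm_eq_abs, abs_of_nonneg (by positivity)]; exact hb N n
  rw [tsum_zero] at hlim
  filter_upwards [hlim.eventually_lt_const hm] with N hN y hy
  have hsA : Summable (fun n => wpbA c n * y ^ n) := by
    refine Summable.of_norm ?_
    simpa only [norm_mul, norm_pow, Real.norm_eq_abs] using wpbA_summable c hc |y| (abs_nonneg y)
  have hsQ : Summable (fun n => (q N).coeff n * y ^ n) := by
    refine Summable.of_norm_bounded (wpbA_summable c hc |y| (abs_nonneg y)) fun n => ?_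
    rw [norm_mul, norm_pow, Real.norm_eq_abs, Real.norm_eq_abs]
    have := h1 N n
    gcongr
  have hsR : Summable (fun n => |(q N).coeff n - wpbA c n| * ρ ^ n) :=
    Summable.of_nonneg_of_le (fun n => by positivity) (hb N) hsum2
  have hdiff : wpbJ c y - (q N).eval y ≤ ∑' n, |(q N).coeff n - wpbA c n| * ρ ^ n := by
    rw [wpb_eval_tsum, wpbJ, ← hsA.tsum_sub hsQ]
    refine (hsA.sub hsQ).tsum_le_tsum (fun n => ?_) hsR
    have hy0 := hy.1
    have hy1 := hy.2
    calc wpbA c n * y ^ n - (q N).coeff n * y ^ n = -((q N).coeff n - wpbA c n) * y ^ n := by ring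
      _ ≤ |(q N).coeff n - wpbA c n| * y ^ n := by gcongr; exact neg_le_abs _
      _ ≤ _ := by gcongr
  have : wpbJ c y0 ≤ wpbJ c y := hmin hy
  linarith


theorem wpb_lim (c : ℝ) (hc : 0 < c) (s ρ : ℝ) (hs : 0 < s) (hsρ : s < ρ)
    (hpos : ∀ y ∈ Icc 0 ρ, 0 < wpbJ c y) (p pm d dm g0 g1 g2 : ℝ) (hp : p = wpbJ c s)
    (hpm : pm = wpbJ c (-s)) (hd : d = wpbD c s) (hdm : dm = wpbD c (-s))
    (hg0 : g0 = - wpbA c 1) (hg1 : g1 = wpbA c 1 ^ 2 - 2 * wpbA c 2)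
    (hg2 : g2 = - wpbA c 1 ^ 3 + 3 * wpbA c 1 * wpbA c 2 - 3 * wpbA c 3) :
    2 * s * (2 * g0 + 2 * s ^ 2 * g2) * (p * pm) ≤ dm * p - d * pm ∧
    (ρ ^ 2 - s ^ 2) * (dm * p - d * pm) ≤
      2 * s * (2 * ρ ^ 2 * g0 - 2 * s ^ 2 * (g0 - ρ ^ 2 * g2)) * (p * pm) ∧
    d * dm ≤ p * pm ∧
    (0 < wpbD c ρ → (ρ ^ 2 - s ^ 2) * (dm * p - d * pm + 8 * ρ * s ^ 3 * (g0 * g2 - g1 ^ 2) * (p * pm)) ≤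
      2 * s * ρ ^ 2 * (2 * g0) * (d * dm)) ∧
    ρ * g1 ≤ g0 ∧ ρ * g2 ≤ g1 ∧ d ≤ p := by
  obtain ⟨q, hq, h1, h2⟩ := wpb_approx c hc
  have hρ : 0 < ρ := hs.trans hsρ
  have lp := wpb_limJ c hc q h1 h2 s
  have lpm := wpb_limJ c hc q h1 h2 (-s)
  have ld := wpb_limD c hc q h1 h2 s
  have ldm := wpb_limD c hc q h1 h2 (-s)
  have ldr := wpb_limD c hc q h1 h2 ρ
  rw [← hp] at lp
  rw [← hpm] at lpm
  rw [← hd] at ld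
  rw [← hdm] at ldm
  have l0 := (h2 1).neg
  have l1 := ((h2 1).pow 2).sub ((h2 2).const_mul 2)
  have l2 := ((((h2 1).pow 3).neg).add (((h2 1).const_mul 3).mul (h2 2))).sub ((h2 3).const_mul 3)
  rw [← hg0] at l0
  rw [← hg1] at l1
  rw [← hg2] at l2
  have hE : ∀ᶠ N in atTop, ∃ (k : ℕ) (t : Fin k → ℝ), (∀ i, 0 ≤ t i) ∧
      q N = ∏ i, (1 - Polynomial.C (t i) * Polynomial.X) ∧ ∀ i, t i * ρ < 1 := by
    filter_upwards [wpb_unif c hc q h1 h2 ρ hρ.le hpos] with N hN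
    obtain ⟨k, t, ht, he⟩ := hq N
    refine ⟨k, t, ht, he, fun i => ?_⟩
    by_contra hcon
    push Not at hcon
    have hti : 0 < t i := by
      rcases (ht i).eq_or_lt with h | h
      · rw [← h] at hcon; norm_num at hcon
      · exact h
    have := hN (1 / t i) ⟨by positivity, by rw [div_le_iff₀ hti]; linarith⟩
    rw [he, wpb_eval_prod, Finset.prod_eq_zero (Finset.mem_univ i)] at this
    · exact lt_irrefl _ this
    · field_simp; ring
  have hK := hE.mono fun N ⟨k, t, ht, he, hr⟩ =>
    wpb_pkg t ht (q N) he s ρ hs hsρ hr _ _ _ _ _ _ _ _ rfl rfl rfl rfl rfl rfl rfl rfl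
  have lP := lp.mul lpm
  have lS := (ldm.mul lp).sub (ld.mul lpm)
  have lE := ld.mul ldm
  refine ⟨?_, ?_, ?_, ?_, ?_, ?_, ?_⟩
  · exact le_of_tendsto_of_tendsto ((((l0.const_mul 2).add (l2.const_mul (2 * s ^ 2))).const_mul (2 * s)).mul lP)
      lS (hK.mono fun N h => h.1)
  · exact le_of_tendsto_of_tendsto (lS.const_mul (ρ ^ 2 - s ^ 2))
      ((((l0.const_mul (2 * ρ ^ 2)).sub ((l0.sub (l2.const_mul (ρ ^ 2))).const_mul (2 * s ^ 2))).const_mul (2 * s)).mul lP)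
      (hK.mono fun N h => h.2.1)
  · exact le_of_tendsto_of_tendsto lE lP (hK.mono fun N h => h.2.2.1)
  · intro hD
    refine le_of_tendsto_of_tendsto
      ((lS.add ((((l0.mul l2).sub (l1.pow 2)).const_mul (8 * ρ * s ^ 3)).mul lP)).const_mul (ρ ^ 2 - s ^ 2))
      (((l0.const_mul 2).const_mul (2 * s * ρ ^ 2)).mul lE) ?_
    filter_upwards [hK, ldr.eventually_const_lt hD] with N h hN
    exact h.2.2.2.1 hN.le
  · exact le_of_tendsto_of_tendsto (l1.const_mul ρ) l0 (hK.mono fun N h => h.2.2.2.2.1)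
  · exact le_of_tendsto_of_tendsto (l2.const_mul ρ) l1 (hK.mono fun N h => h.2.2.2.2.2.1)
  · exact le_of_tendsto_of_tendsto ld lp (hK.mono fun N h => h.2.2.2.2.2.2)

theorem wpb_closed (c : ℝ) (hc : 0 < c) (s ρ : ℝ) (hs : 0 < s) (hsρ : s < ρ)
    (hpos : ∀ y, 0 ≤ y → y < ρ → 0 < wpbJ c y) (p pm d dm g0 g1 g2 : ℝ) (hp : p = wpbJ c s)
    (hpm : pm = wpbJ c (-s)) (hd : d = wpbD c s) (hdm : dm = wpbD c (-s))
    (hg0 : g0 = - wpbA c 1) (hg1 : g1 = wpbA c 1 ^ 2 - 2 * wpbA c 2)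
    (hg2 : g2 = - wpbA c 1 ^ 3 + 3 * wpbA c 1 * wpbA c 2 - 3 * wpbA c 3) :
    2 * s * (2 * g0 + 2 * s ^ 2 * g2) * (p * pm) ≤ dm * p - d * pm ∧
    (ρ ^ 2 - s ^ 2) * (dm * p - d * pm) ≤
      2 * s * (2 * ρ ^ 2 * g0 - 2 * s ^ 2 * (g0 - ρ ^ 2 * g2)) * (p * pm) ∧
    d * dm ≤ p * pm ∧
    ((∀ y, 0 ≤ y → y < ρ → 0 < wpbD c y) →
      (ρ ^ 2 - s ^ 2) * (dm * p - d * pm + 8 * ρ * s ^ 3 * (g0 * g2 - g1 ^ 2) * (p * pm)) ≤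
      2 * s * ρ ^ 2 * (2 * g0) * (d * dm)) ∧
    ρ * g1 ≤ g0 ∧ ρ * g2 ≤ g1 ∧ d ≤ p := by
  have hK : ∀ r, s < r → r < ρ → _ := fun r h1 h2 =>
    wpb_lim c hc s r hs h1 (fun y hy => hpos y hy.1 (hy.2.trans_lt h2)) p pm d dm g0 g1 g2
      hp hpm hd hdm hg0 hg1 hg2
  have hev : ∀ᶠ r in 𝓝[<] ρ, s < r ∧ r < ρ := by
    filter_upwards [Ioo_mem_nhdsLT hsρ] with r hr using hr
  have cl : ∀ f g : ℝ → ℝ, Continuous f → Continuous g → (∀ r, s < r → r < ρ → f r ≤ g r) → f ρ ≤ g ρ := by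
    intro f g hf hg h
    exact le_of_tendsto_of_tendsto (hf.continuousAt.tendsto.mono_left nhdsWithin_le_nhds)
      (hg.continuousAt.tendsto.mono_left nhdsWithin_le_nhds) (hev.mono fun r hr => h r hr.1 hr.2)
  obtain ⟨m, hm1, hm2⟩ := exists_between hsρ
  have hM := hK m hm1 hm2
  refine ⟨hM.1, ?_, hM.2.2.1, ?_, ?_, ?_, hM.2.2.2.2.2.2⟩
  · exact cl (fun r => (r ^ 2 - s ^ 2) * (dm * p - d * pm))
      (fun r => 2 * s * (2 * r ^ 2 * g0 - 2 * s ^ 2 * (g0 - r ^ 2 * g2)) * (p * pm))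
      (by fun_prop) (by fun_prop) (fun r h1 h2 => (hK r h1 h2).2.1)
  · intro hD
    exact cl (fun r => (r ^ 2 - s ^ 2) * (dm * p - d * pm + 8 * r * s ^ 3 * (g0 * g2 - g1 ^ 2) * (p * pm)))
      (fun r => 2 * s * r ^ 2 * (2 * g0) * (d * dm))
      (by fun_prop) (by fun_prop)
      (fun r h1 h2 => (hK r h1 h2).2.2.2.1 (hD r (hs.trans h1).le h2))
  · exact cl (fun r => r * g1) (fun _ => g0) (by fun_prop) (by fun_prop)
      (fun r h1 h2 => (hK r h1 h2).2.2.2.2.1)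
  · exact cl (fun r => r * g2) (fun _ => g1) (by fun_prop) (by fun_prop)
      (fun r h1 h2 => (hK r h1 h2).2.2.2.2.2.1)

theorem wpbJ_neg_pos (c : ℝ) (hc : 0 < c) (s : ℝ) (hs : 0 < s) : 0 < wpbJ c (-s) := by
  have hsA : Summable (fun n => wpbA c n * (-s) ^ n) := by
    refine Summable.of_norm ?_
    simpa only [norm_mul, norm_pow, Real.norm_eq_abs] using wpbA_summable c hc |-s| (abs_nonneg _)
  refine hsA.tsum_pos (fun n => ?_) 0 ?_
  · rw [wpbA, div_mul_eq_mul_div, ← mul_pow]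
    have := wpbRf_pos c hc n
    have : 0 ≤ -1 / 4 * -s := by linarith
    positivity
  · simp [wpbA, wpbRf]

theorem wpb_first_pos (f : ℝ → ℝ) (hf : Continuous f) (h0 : f 0 = 1) (ρ : ℝ)
    (hmin : ∀ y, 0 < y → y < ρ → f y ≠ 0) : ∀ y, 0 ≤ y → y < ρ → 0 < f y := by
  intro y hy hyρ
  by_contra hcon
  push Not at hcon
  obtain ⟨z, hz, hz0⟩ := intermediate_value_Icc' hy hf.continuousOn (show (0:ℝ) ∈ Icc (f y) (f 0) from ⟨hcon, by rw [h0]; exact zero_le_one⟩)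
  rcases hz.1.eq_or_lt with h | h
  · rw [← h, h0] at hz0; exact one_ne_zero hz0
  · exact hmin z h (hz.2.trans_lt hyρ) hz0

theorem wpb_g (c : ℝ) (hc : 0 < c) : wpbA c 1 = -1 / (4 * c) ∧ wpbA c 2 = 1 / (32 * c * (c + 1)) ∧
    wpbA c 3 = -1 / (384 * c * (c + 1) * (c + 2)) := by
  refine ⟨?_, ?_, ?_⟩ <;> simp [wpbA, wpbRf, Finset.prod_range_succ, Nat.factorial] <;> field_simp <;> norm_num

theorem wpb_gpos (c : ℝ) (hc : 0 < c) (g0 g1 g2 : ℝ)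
    (hg0 : g0 = - wpbA c 1) (hg1 : g1 = wpbA c 1 ^ 2 - 2 * wpbA c 2)
    (hg2 : g2 = - wpbA c 1 ^ 3 + 3 * wpbA c 1 * wpbA c 2 - 3 * wpbA c 3) :
    4 * c * g0 = 1 ∧ 0 < g2 ∧ 0 < g0 * g2 - g1 ^ 2 := by
  obtain ⟨a1, a2, a3⟩ := wpb_g c hc
  rw [a1] at hg0
  rw [a1, a2] at hg1
  rw [a1, a2, a3] at hg2
  have e1 : g1 = 1 / (16 * c ^ 2 * (c + 1)) := by rw [hg1]; field_simp; ring
  have e2 : g2 = 1 / (32 * c ^ 3 * (c + 1) * (c + 2)) := by rw [hg2]; field_simp; ring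
  refine ⟨?_, ?_, ?_⟩
  · rw [hg0]; field_simp
  · rw [e2]; positivity
  · have : g0 * g2 - g1 ^ 2 = c / (256 * c ^ 4 * (c + 1) ^ 2 * (c + 2)) := by
      rw [hg0, e1, e2]; field_simp; ring
    rw [this]; positivity

theorem wpb_fin_algJ (c W s ρ P g0 g1 g2 : ℝ) (hc : 0 < c) (hs : 0 < s) (hsρ : s < ρ) (P0 : 0 < P)
    (e0 : 4 * c * g0 = 1) (e2 : 0 < g2) (e3 : 0 < g0 * g2 - g1 ^ 2)
    (h1 : 2 * s * (2 * g0 + 2 * s ^ 2 * g2) * P ≤ W * s / c)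
    (h2 : (ρ ^ 2 - s ^ 2) * (W * s / c) ≤ 2 * s * (2 * ρ ^ 2 * g0 - 2 * s ^ 2 * (g0 - ρ ^ 2 * g2)) * P)
    (h6 : ρ * g2 ≤ g1) : P < W ∧ (ρ ^ 2 - s ^ 2) * W < ρ ^ 2 * P := by
  have hρ : 0 < ρ := hs.trans hsρ
  have k0 : 0 < c / s := by positivity
  have k1 := mul_le_mul_of_nonneg_left h1 k0.le
  have k2 := mul_le_mul_of_nonneg_left h2 k0.le
  have r1 : c / s * (W * s / c) = W := by field_simp
  have r2 : c / s * ((ρ ^ 2 - s ^ 2) * (W * s / c)) = (ρ ^ 2 - s ^ 2) * W := by field_simp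
  have r3 : c / s * (2 * s * (2 * g0 + 2 * s ^ 2 * g2) * P) = (4 * c * g0 + 4 * c * s ^ 2 * g2) * P := by
    field_simp; ring
  have r4 : c / s * (2 * s * (2 * ρ ^ 2 * g0 - 2 * s ^ 2 * (g0 - ρ ^ 2 * g2)) * P)
      = (ρ ^ 2 * (4 * c * g0) - 4 * c * s ^ 2 * (g0 - ρ ^ 2 * g2)) * P := by field_simp; ring
  rw [r1, r3, e0] at k1
  rw [r2, r4, e0] at k2
  have hg : 0 < g0 - ρ ^ 2 * g2 := by
    have a : (ρ * g2) ^ 2 ≤ g1 ^ 2 := pow_le_pow_left₀ (by positivity) h6 2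
    have b : 0 < g2 * (g0 - ρ ^ 2 * g2) := by nlinarith
    exact pos_of_mul_pos_right b e2.le
  have u : 0 < 4 * c * s ^ 2 * g2 * P := by positivity
  have v : 0 < 4 * c * s ^ 2 * (g0 - ρ ^ 2 * g2) * P := by positivity
  constructor <;> linarith

theorem wpb_fin_algD (c W s ρ P E g0 Δ : ℝ) (hc : 0 < c) (hs : 0 < s) (hsρ : s < ρ) (P0 : 0 < P)
    (e0 : 4 * c * g0 = 1) (e3 : 0 < Δ)
    (h4 : (ρ ^ 2 - s ^ 2) * (W * s / c + 8 * ρ * s ^ 3 * Δ * P) ≤ 2 * s * ρ ^ 2 * (2 * g0) * E) :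
    (ρ ^ 2 - s ^ 2) * W < ρ ^ 2 * E := by
  have hρ : 0 < ρ := hs.trans hsρ
  have k0 : 0 < c / s := by positivity
  have k1 := mul_le_mul_of_nonneg_left h4 k0.le
  have r1 : c / s * ((ρ ^ 2 - s ^ 2) * (W * s / c + 8 * ρ * s ^ 3 * Δ * P)) =
      (ρ ^ 2 - s ^ 2) * W + (ρ ^ 2 - s ^ 2) * (8 * c * ρ * s ^ 2 * Δ * P) := by field_simp
  have r2 : c / s * (2 * s * ρ ^ 2 * (2 * g0) * E) = (4 * c * g0) * ρ ^ 2 * E := by field_simp; ring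
  rw [r1, r2, e0] at k1
  have hρs : 0 < ρ ^ 2 - s ^ 2 := by nlinarith
  have u : 0 < (ρ ^ 2 - s ^ 2) * (8 * c * ρ * s ^ 2 * Δ * P) := by positivity
  linarith

theorem wpb_J_bounds (c : ℝ) (hc : 0 < c) (W s ρ : ℝ) (hs : 0 < s) (hsρ : s < ρ)
    (hW : W * s = -c * (wpbD c s * wpbJ c (-s) - wpbD c (-s) * wpbJ c s))
    (hpos : ∀ y, 0 ≤ y → y < ρ → 0 < wpbJ c y) :
    wpbJ c s * wpbJ c (-s) < W ∧ (ρ ^ 2 - s ^ 2) * W < ρ ^ 2 * (wpbJ c s * wpbJ c (-s)) := by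
  obtain ⟨h1, h2, -, -, h5, h6, -⟩ := wpb_closed c hc s ρ hs hsρ hpos _ _ _ _ _ _ _ rfl rfl rfl rfl rfl rfl rfl
  obtain ⟨e0, e2, e3⟩ := wpb_gpos c hc _ _ _ rfl rfl rfl
  have P0 : 0 < wpbJ c s * wpbJ c (-s) := mul_pos (hpos s hs.le hsρ) (wpbJ_neg_pos c hc s hs)
  have hS : wpbD c (-s) * wpbJ c s - wpbD c s * wpbJ c (-s) = W * s / c := by
    rw [hW]; field_simp; ring
  rw [hS] at h1 h2
  exact wpb_fin_algJ c W s ρ _ _ _ _ hc hs hsρ P0 e0 e2 e3 h1 h2 h6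

theorem wpb_D_bounds (c : ℝ) (hc : 0 < c) (W s ρ ρJ : ℝ) (hs : 0 < s) (hsρ : s < ρ)
    (hW : W * s = -c * (wpbD c s * wpbJ c (-s) - wpbD c (-s) * wpbJ c s))
    (hρJ : 0 < ρJ) (hJ0 : wpbJ c ρJ = 0)
    (hposJ : ∀ y, 0 ≤ y → y < ρJ → 0 < wpbJ c y)
    (hposD : ∀ y, 0 ≤ y → y < ρ → 0 < wpbD c y) :
    wpbD c s * wpbD c (-s) < W ∧ (ρ ^ 2 - s ^ 2) * W < ρ ^ 2 * (wpbD c s * wpbD c (-s)) := by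
  have hle : ρ ≤ ρJ := by
    by_contra hcon
    push Not at hcon
    have h1 := hposD ρJ hρJ.le hcon
    have h2 : wpbD c ρJ ≤ wpbJ c ρJ := by
      refine le_of_tendsto_of_tendsto (((wpbD_cont c hc).continuousAt (x := ρJ)).tendsto.mono_left (nhdsWithin_le_nhds (s := Iio ρJ)))
        (((wpbJ_cont c hc).continuousAt).tendsto.mono_left nhdsWithin_le_nhds) ?_
      filter_upwards [Ioo_mem_nhdsLT hρJ] with r hr
      exact (wpb_closed c hc r ρJ hr.1 hr.2 hposJ _ _ _ _ _ _ _ rfl rfl rfl rfl rfl rfl rfl).2.2.2.2.2.2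
    linarith
  have hpos : ∀ y, 0 ≤ y → y < ρ → 0 < wpbJ c y := fun y h1 h2 => hposJ y h1 (h2.trans_le hle)
  obtain ⟨-, -, h3, h4, -, -, -⟩ := wpb_closed c hc s ρ hs hsρ hpos _ _ _ _ _ _ _ rfl rfl rfl rfl rfl rfl rfl
  obtain ⟨e0, e2, e3⟩ := wpb_gpos c hc _ _ _ rfl rfl rfl
  have P0 : 0 < wpbJ c s * wpbJ c (-s) := mul_pos (hpos s hs.le hsρ) (wpbJ_neg_pos c hc s hs)
  have hS : wpbD c (-s) * wpbJ c s - wpbD c s * wpbJ c (-s) = W * s / c := by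
    rw [hW]; field_simp; ring
  have h4 := h4 hposD
  rw [hS] at h4
  exact ⟨h3.trans_lt (wpb_J_bounds c hc W s ρ hs hsρ hW hpos).1,
    wpb_fin_algD c W s ρ _ _ _ _ hc hs hsρ P0 e0 e3 h4⟩

theorem wpb_Gamma (c : ℝ) (hc : 0 < c) (n : ℕ) : Real.Gamma (c + n) = Real.Gamma c * wpbRf c n := by
  induction n with
  | zero => simp [wpbRf]
  | succ n ih =>
    rw [wpbRf_succ, Nat.cast_succ, ← add_assoc, Real.Gamma_add_one (by positivity), ih]; ring

theorem wpb_coefA (ν : ℝ) (hν : -1 < ν) (n : ℕ) (e a x : ℝ) :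
    e ^ n * a * Real.Gamma (ν + 1) * x ^ (2 * n) /
    ((2 : ℝ) ^ (2 * n) * (n.factorial : ℝ) * Real.Gamma (ν + n + 1)) =
      a * wpbA (ν + 1) n * (-e * x ^ 2) ^ n := by
  have hc : 0 < ν + 1 := by linarith
  have hG := (Real.Gamma_pos_of_pos hc).ne'
  have hR := (wpbRf_pos (ν + 1) hc n).ne'
  rw [show ν + n + 1 = ν + 1 + n by ring, wpb_Gamma _ hc, wpbA, pow_mul, pow_mul, mul_pow,
    show (2:ℝ) ^ 2 = 4 by norm_num, show (-1 / 4 : ℝ) = -1 * (1 / 4) by norm_num, mul_pow, neg_pow e,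
    div_pow, one_pow]
  have : ((-1 : ℝ) ^ n) * (-1) ^ n = 1 := by rw [← mul_pow]; norm_num
  field_simp
  linear_combination (-(e ^ n * a * x ^ (2 * n))) * this

theorem wpb_coefB (ν : ℝ) (hν : -1 < ν) (n : ℕ) (x : ℝ) :
    (-1 : ℝ) ^ n * (Real.Gamma (ν + 1) * Real.Gamma (ν + 2)) * x ^ (4 * n) /
    ((2 : ℝ) ^ (4 * n) * (n.factorial : ℝ) * Real.Gamma (ν + n + 1) * Real.Gamma (ν + 2 * n + 2)) =
      wpbB (ν + 1) n * (x ^ 2) ^ (2 * n) := by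
  have hc : 0 < ν + 1 := by linarith
  have hc2 : 0 < ν + 2 := by linarith
  have hG := (Real.Gamma_pos_of_pos hc).ne'
  have hG2 := (Real.Gamma_pos_of_pos hc2).ne'
  have hR := (wpbRf_pos (ν + 1) hc n).ne'
  have hR2 := (wpbRf_pos (ν + 2) hc2 (2 * n)).ne'
  have e := wpb_Gamma _ hc2 (2 * n)
  push_cast at e
  rw [show ν + n + 1 = ν + 1 + n by ring, wpb_Gamma _ hc, show ν + 2 * n + 2 = ν + 2 + 2 * n by ring,
    e, wpbB, show ν + 1 + 1 = ν + 2 by ring, ← pow_mul, show 2 * (2 * n) = 4 * n by ring, pow_mul 2 4,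
    show (2:ℝ) ^ 4 = 16 by norm_num, div_pow]
  field_simp


theorem wpb_Dcal (ν : ℝ) (hν : -1 < ν) (x : ℝ) : Dcal ν x = wpbD (ν + 1) (x ^ 2) := by
  rw [Dcal, wpbD]
  refine tsum_congr fun n => ?_
  rw [wpb_coefA ν hν n (-1) (2 * n + 1) x]; simp

theorem wpb_lamDini (ν : ℝ) (hν : -1 < ν) (x : ℝ) : lamDini ν x = wpbD (ν + 1) (-x ^ 2) := by
  rw [lamDini, wpbD]
  refine tsum_congr fun n => ?_
  have := wpb_coefA ν hν n 1 (2 * n + 1) x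
  rw [one_pow, one_mul, neg_one_mul] at this
  exact this

theorem wpb_Jcal (ν : ℝ) (hν : -1 < ν) (x : ℝ) : Jcal ν x = wpbJ (ν + 1) (x ^ 2) := by
  rw [Jcal, wpbJ]
  refine tsum_congr fun n => ?_
  have := wpb_coefA ν hν n (-1) 1 x
  rw [mul_one, one_mul, neg_neg, one_mul] at this
  exact this

theorem wpb_Ical (ν : ℝ) (hν : -1 < ν) (x : ℝ) : Ical ν x = wpbJ (ν + 1) (-x ^ 2) := by
  rw [Ical, wpbJ]
  refine tsum_congr fun n => ?_
  have := wpb_coefA ν hν n 1 1 x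
  rw [one_pow, one_mul, one_mul, one_mul, neg_one_mul] at this
  exact this

theorem wpb_Wcal (ν : ℝ) (hν : -1 < ν) (x : ℝ) : Wcal ν x * x ^ 2 =
    -(ν + 1) * (wpbD (ν + 1) (x ^ 2) * wpbJ (ν + 1) (-x ^ 2) - wpbD (ν + 1) (-x ^ 2) * wpbJ (ν + 1) (x ^ 2)) := by
  rw [← (wpb_cross (ν + 1) (by linarith) (x ^ 2)).tsum_eq, tsum_mul_right, Wcal]
  congr 1
  exact tsum_congr fun n => wpb_coefB ν hν n x

theorem wpb_upper (a x W P : ℝ) (hx : |x| < a)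
    (h : ((a ^ 2) ^ 2 - (x ^ 2) ^ 2) * W < (a ^ 2) ^ 2 * P) : W < a ^ 4 / (a ^ 4 - x ^ 4) * P := by
  have h2 : x ^ 2 < a ^ 2 := sq_lt_sq' (by linarith [neg_abs_le x]) (by linarith [le_abs_self x])
  have h4 : 0 < a ^ 4 - x ^ 4 := by nlinarith [sq_nonneg x]
  rw [div_mul_eq_mul_div, lt_div_iff₀ h4]
  linarith

theorem wpb_zero_min (f : ℝ → ℝ) (a : ℝ) (ha : 0 < a) (hmin : ∀ x : ℝ, 0 < x → f (x ^ 2) = 0 → a ≤ x) :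
    ∀ y, 0 < y → y < a ^ 2 → f y ≠ 0 := by
  intro y hy hya h0
  have h1 := hmin (√y) (Real.sqrt_pos.2 hy) (by rw [Real.sq_sqrt hy.le]; exact h0)
  have h2 := pow_le_pow_left₀ ha.le h1 2
  rw [Real.sq_sqrt hy.le] at h2
  linarith

end WpbHelpers

/-- Lower and upper bounds for the normalized cross-product `𝒲_ν` in terms of products of
normalized Dini functions and of normalized Bessel functions. -/
theorem Wcal_product_bounds (ν : ℝ) (hν : -1 < ν) (α1 j1 : ℝ)
    (hα1pos : 0 < α1) (hα1zero : Dcal ν α1 = 0)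
    (hα1min : ∀ x : ℝ, 0 < x → Dcal ν x = 0 → α1 ≤ x)
    (hj1pos : 0 < j1) (hj1zero : Jcal ν j1 = 0)
    (hj1min : ∀ x : ℝ, 0 < x → Jcal ν x = 0 → j1 ≤ x) :
    (∀ x : ℝ, 0 < |x| → |x| < α1 →
      Dcal ν x * lamDini ν x < Wcal ν x ∧
      Wcal ν x < α1 ^ 4 / (α1 ^ 4 - x ^ 4) * (Dcal ν x * lamDini ν x)) ∧
    (∀ x : ℝ, 0 < |x| → |x| < j1 →
      Jcal ν x * Ical ν x < Wcal ν x ∧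
      Wcal ν x < j1 ^ 4 / (j1 ^ 4 - x ^ 4) * (Jcal ν x * Ical ν x)) := by
  have hc : 0 < ν + 1 := by linarith
  simp only [wpb_Dcal ν hν, wpb_Jcal ν hν, wpb_lamDini ν hν, wpb_Ical ν hν] at *
  have hJ := wpb_first_pos (wpbJ (ν + 1)) (wpbJ_cont _ hc) (wpbJ_zero _) (j1 ^ 2)
    (wpb_zero_min _ j1 hj1pos hj1min)
  have hD := wpb_first_pos (wpbD (ν + 1)) (wpbD_cont _ hc) (wpbD_zero _) (α1 ^ 2)
    (wpb_zero_min _ α1 hα1pos hα1min)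
  have hsq : ∀ x a : ℝ, |x| < a → x ^ 2 < a ^ 2 := fun x a hx =>
    sq_lt_sq' (by linarith [neg_abs_le x]) (by linarith [le_abs_self x])
  constructor
  · intro x hx0 hx
    have hs : 0 < x ^ 2 := by have := abs_pos.1 hx0; positivity
    obtain ⟨h1, h2⟩ := wpb_D_bounds (ν + 1) hc (Wcal ν x) (x ^ 2) (α1 ^ 2) (j1 ^ 2) hs (hsq x α1 hx)
      (wpb_Wcal ν hν x) (by positivity) hj1zero hJ hD
    exact ⟨h1, wpb_upper α1 x _ _ hx h2⟩
  · intro x hx0 hx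
    have hs : 0 < x ^ 2 := by have := abs_pos.1 hx0; positivity
    obtain ⟨h1, h2⟩ := wpb_J_bounds (ν + 1) hc (Wcal ν x) (x ^ 2) (j1 ^ 2) hs (hsq x j1 hx)
      (wpb_Wcal ν hν x) hJ
    exact ⟨h1, wpb_upper j1 x _ _ hx h2⟩
end

section
/- Let ν > -1 and let j_{ν,1} be the smallest positive zero of 𝒥_ν. Then for all x with 0 < x < j_{ν,1}: e^{x²/(2(ν+1))} < I_ν(x)/J_ν(x) < ((j_{ν,1}² + x²)/(j_{ν,1}² - x²))^{j_{ν,1}²/(4(ν+1))}. -/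
open Real Set

/-- Integrating-factor lemma. -/
lemma intfac_nonneg {n T : ℝ} (hn : 0 < n) (hT : 0 < T) (g g' : ℝ → ℝ)
    (hc : ContinuousOn g (Icc 0 T)) (hd : ∀ s ∈ Ioo 0 T, HasDerivAt g (g' s) s)
    (hp : ∀ s ∈ Ioo 0 T, 0 ≤ s * g' s + n * g s) : 0 ≤ g T := by
  have hmono : MonotoneOn (fun s => s ^ n * g s) (Icc 0 T) := by
    apply monotoneOn_of_deriv_nonneg (convex_Icc 0 T)
    · exact (continuousOn_id.rpow_const (fun x _ => Or.inr hn.le)).mul hc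
    · rw [interior_Icc]
      intro s hs
      exact ((Real.hasDerivAt_rpow_const (p := n) (Or.inl hs.1.ne')).mul
        (hd s hs)).differentiableAt.differentiableWithinAt
    · rw [interior_Icc]
      intro s hs
      have h := ((Real.hasDerivAt_rpow_const (p := n) (Or.inl hs.1.ne')).mul (hd s hs)).deriv
      have e : deriv (fun s => s ^ n * g s) s = s ^ (n - 1) * (s * g' s + n * g s) := by
        refine h.trans ?_
        have : s ^ n = s ^ (n - 1) * s := by
          rw [← Real.rpow_add_one hs.1.ne']; ring_nf
        rw [this]; ring
      rw [e]
      exact mul_nonneg (Real.rpow_nonneg hs.1.le _) (hp s hs)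
  have h := hmono (left_mem_Icc.2 hT.le) (right_mem_Icc.2 hT.le) hT.le
  simp only [Real.zero_rpow hn.ne', zero_mul] at h
  exact nonneg_of_mul_nonneg_right h (Real.rpow_pos_of_pos hT n)

lemma intfac_pos {n T : ℝ} (hn : 0 < n) (hT : 0 < T) (g g' : ℝ → ℝ)
    (hc : ContinuousOn g (Icc 0 T)) (hd : ∀ s ∈ Ioo 0 T, HasDerivAt g (g' s) s)
    (hp : ∀ s ∈ Ioo 0 T, 0 < s * g' s + n * g s) : 0 < g T := by
  have hmono : StrictMonoOn (fun s => s ^ n * g s) (Icc 0 T) := by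
    apply strictMonoOn_of_deriv_pos (convex_Icc 0 T)
    · exact (continuousOn_id.rpow_const (fun x _ => Or.inr hn.le)).mul hc
    · rw [interior_Icc]
      intro s hs
      have h := ((Real.hasDerivAt_rpow_const (p := n) (Or.inl hs.1.ne')).mul (hd s hs)).deriv
      have e : deriv (fun s => s ^ n * g s) s = s ^ (n - 1) * (s * g' s + n * g s) := by
        refine h.trans ?_
        have : s ^ n = s ^ (n - 1) * s := by
          rw [← Real.rpow_add_one hs.1.ne']; ring_nf
        rw [this]; ring
      rw [e]
      exact mul_pos (Real.rpow_pos_of_pos hs.1 _) (hp s hs)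
  have h := hmono (left_mem_Icc.2 hT.le) (right_mem_Icc.2 hT.le) hT
  simp only [Real.zero_rpow hn.ne', zero_mul] at h
  exact pos_of_mul_pos_right h (Real.rpow_nonneg hT.le n)

/-- The ODE data of the normalized Bessel function in the variable `t = x ^ 2`. -/
structure BesselSys (n a : ℝ) (F F1 F2 : ℝ → ℝ) : Prop where
  n_pos : 0 < n
  a_pos : 0 < a
  d0 : ∀ t, HasDerivAt F (F1 t) t
  d1 : ∀ t, HasDerivAt F1 (F2 t) t
  ode : ∀ t, t * F2 t + n * F1 t + F t / 4 = 0
  F0 : F 0 = 1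
  pos : ∀ t < a, 0 < F t

namespace BesselSys

variable {n a : ℝ} {F F1 F2 : ℝ → ℝ}

lemma F1_zero (h : BesselSys n a F F1 F2) : -F1 0 / F 0 = 1 / (4 * n) := by
  have := h.ode 0
  have hn := h.n_pos
  rw [h.F0] at *
  field_simp
  linarith

/-- Derivative of the negative logarithmic derivative of F. -/
lemma hasDerivAt_u (h : BesselSys n a F F1 F2) {t : ℝ} (ht : t < a) :
    HasDerivAt (fun t => -F1 t / F t) (-F2 t / F t + (-F1 t / F t) ^ 2) t := by
  have hF := (h.pos t ht).ne'
  refine ((h.d1 t).neg.div (h.d0 t) hF).congr_deriv ?_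
  simp only [Pi.neg_apply]
  field_simp
  ring

lemma riccati (h : BesselSys n a F F1 F2) {t : ℝ} (ht : t < a) :
    t * (-F2 t / F t + (-F1 t / F t) ^ 2) =
      t * (-F1 t / F t) ^ 2 - n * (-F1 t / F t) + 1 / 4 := by
  have hF := (h.pos t ht).ne'
  have := h.ode t
  field_simp
  linear_combination (-4) * F t * this

/-- abstract Riccati pair -/
lemma exists_uv (h : BesselSys n a F F1 F2) : ∃ u v u' v' : ℝ → ℝ,
    (∀ t, u t = -F1 t / F t) ∧ (∀ t, v t = -F1 (-t) / F (-t)) ∧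
    (∀ t, t < a → HasDerivAt u (u' t) t) ∧ (∀ t, -t < a → HasDerivAt v (v' t) t) ∧
    (∀ t, t < a → t * u' t = t * u t ^ 2 - n * u t + 1 / 4) ∧
    (∀ t, -t < a → t * v' t = -t * v t ^ 2 - n * v t + 1 / 4) ∧
    u 0 = 1 / (4 * n) ∧ v 0 = 1 / (4 * n) ∧
    (∀ t, 0 < t → 0 < v t) := by
  refine ⟨fun t => -F1 t / F t, fun t => -F1 (-t) / F (-t),
    fun t => -F2 t / F t + (-F1 t / F t) ^ 2,
    fun t => -(-F2 (-t) / F (-t) + (-F1 (-t) / F (-t)) ^ 2), fun _ => rfl, fun _ => rfl,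
    fun t ht => h.hasDerivAt_u ht, ?_, fun t ht => h.riccati ht, ?_, h.F1_zero, ?_, ?_⟩
  · intro t ht
    have := (h.hasDerivAt_u ht).comp t (hasDerivAt_neg t)
    refine this.congr_deriv ?_
    ring
  · intro t ht
    have := h.riccati ht
    dsimp only
    linarith
  · simpa using h.F1_zero
  · intro t ht
    have ha := h.a_pos
    refine div_pos ?_ (h.pos _ (by linarith))
    apply intfac_pos h.n_pos ht (fun s => -F1 (-s)) (fun s => F2 (-s))
    · have : Continuous F1 := continuous_iff_continuousAt.2 fun t => (h.d1 t).continuousAt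
      fun_prop
    · intro s _
      have := ((h.d1 (-s)).comp s (hasDerivAt_neg s)).neg
      refine this.congr_deriv ?_
      ring
    · intro s hs
      have h1 := h.ode (-s)
      have h2 := h.pos (-s) (by linarith [hs.1])
      linarith

/-- Key inequality. -/
lemma key (h : BesselSys n a F F1 F2) {t b : ℝ} (ht : 0 < t) (htb : t < b) (hba : b < a) :
    0 ≤ (1 - b ^ 2 / t ^ 2) * (2 - 4 * (n - 1) * (-F1 t / F t) + 4 * t * (-F1 t / F t) ^ 2
        - 4 * (n - 1) * (-F1 (-t) / F (-t)) - 4 * t * (-F1 (-t) / F (-t)) ^ 2)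
      + 4 * (1 + b ^ 2 / t ^ 2) * (-F1 t / F t + -F1 (-t) / F (-t)) := by
  have hFt := h.pos t (by linarith)
  have hFm := h.pos (-t) (by linarith)
  obtain ⟨B, hB⟩ : ∃ B : ℝ → ℝ, B = fun s => F (t * s) / F t := ⟨_, rfl⟩
  obtain ⟨B1, hB1⟩ : ∃ B1 : ℝ → ℝ, B1 = fun s => t * F1 (t * s) / F t := ⟨_, rfl⟩
  obtain ⟨B2, hB2⟩ : ∃ B2 : ℝ → ℝ, B2 = fun s => t * (t * F2 (t * s)) / F t := ⟨_, rfl⟩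
  obtain ⟨C, hC⟩ : ∃ C : ℝ → ℝ, C = fun s => F (-t * s) / F (-t) := ⟨_, rfl⟩
  obtain ⟨C1, hC1⟩ : ∃ C1 : ℝ → ℝ, C1 = fun s => -t * F1 (-t * s) / F (-t) := ⟨_, rfl⟩
  obtain ⟨C2, hC2⟩ : ∃ C2 : ℝ → ℝ, C2 = fun s => -t * (-t * F2 (-t * s)) / F (-t) := ⟨_, rfl⟩
  obtain ⟨A, hA⟩ : ∃ A : ℝ → ℝ, A = fun s => F (b * s) := ⟨_, rfl⟩
  obtain ⟨A1, hA1⟩ : ∃ A1 : ℝ → ℝ, A1 = fun s => b * F1 (b * s) := ⟨_, rfl⟩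
  obtain ⟨A2, hA2⟩ : ∃ A2 : ℝ → ℝ, A2 = fun s => b * (b * F2 (b * s)) := ⟨_, rfl⟩
  have lin : ∀ c s : ℝ, HasDerivAt (fun s => c * s) c s := fun c s => by
    simpa using (hasDerivAt_id s).const_mul c
  have D0 : ∀ c s, HasDerivAt (fun s => F (c * s)) (c * F1 (c * s)) s := fun c s => by
    refine ((h.d0 (c * s)).comp s (lin c s)).congr_deriv (by ring)
  have D1 : ∀ c s, HasDerivAt (fun s => c * F1 (c * s)) (c * (c * F2 (c * s))) s := fun c s => by
    refine (((h.d1 (c * s)).comp s (lin c s)).const_mul c).congr_deriv (by ring)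
  have dB : ∀ s, HasDerivAt B (B1 s) s := fun s => by
    rw [hB, hB1]; exact (D0 t s).div_const _
  have dB1 : ∀ s, HasDerivAt B1 (B2 s) s := fun s => by
    rw [hB1, hB2]; exact (D1 t s).div_const _
  have dC : ∀ s, HasDerivAt C (C1 s) s := fun s => by
    rw [hC, hC1]; exact (D0 (-t) s).div_const _
  have dC1 : ∀ s, HasDerivAt C1 (C2 s) s := fun s => by
    rw [hC1, hC2]; exact (D1 (-t) s).div_const _
  have dA : ∀ s, HasDerivAt A (A1 s) s := fun s => by
    rw [hA, hA1]; exact D0 b s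
  have dA1 : ∀ s, HasDerivAt A1 (A2 s) s := fun s => by
    rw [hA1, hA2]; exact D1 b s
  have oB : ∀ s, s * B2 s = -n * B1 s - t * B s / 4 := fun s => by
    rw [hB, hB1, hB2]
    have := h.ode (t * s)
    linear_combination (t / F t) * this
  have oC : ∀ s, s * C2 s = -n * C1 s + t * C s / 4 := fun s => by
    rw [hC, hC1, hC2]
    have := h.ode (-t * s)
    linear_combination (-t / F (-t)) * this
  have oA : ∀ s, s * A2 s = -n * A1 s - b * A s / 4 := fun s => by
    rw [hA, hA1, hA2]
    have := h.ode (b * s)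
    linear_combination b * this
  have Apos : ∀ s ∈ Icc (0:ℝ) 1, 0 < A s := fun s hs => by
    rw [hA]
    apply h.pos
    nlinarith [hs.1, hs.2]
  have eB : B 1 = 1 := by rw [hB]; simp [hFt.ne']
  have eC : C 1 = 1 := by rw [hC]; simp [hFm.ne']
  have eB1 : B1 1 = -t * (-F1 t / F t) := by rw [hB1]; simp; ring
  have eC1 : C1 1 = t * (-F1 (-t) / F (-t)) := by rw [hC1]; simp; ring
  clear hB hB1 hB2 hC hC1 hC2 hA hA1 hA2 D0 D1
  obtain ⟨g, hg⟩ : ∃ g : ℝ → ℝ, g = fun s =>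
    1 / 4 * ((1 - b ^ 2 / t ^ 2) * ((B s ^ 2 + 4 * (n - 1) / t * (B s * B1 s)
        + 4 / t * (s * B1 s ^ 2))
      + (C s ^ 2 - 4 * (n - 1) / t * (C s * C1 s) - 4 / t * (s * C1 s ^ 2)))
      + 4 / t * (1 + b ^ 2 / t ^ 2) * (B s * C1 s - B1 s * C s))
    + 8 * b * ((B s - C s) / (2 * t) * ((B1 s - C1 s) / (2 * t))
      - ((B s - C s) / (2 * t)) ^ 2 * (A1 s / A s)) := ⟨_, rfl⟩
  have hgd : ∀ s ∈ Icc (0:ℝ) 1, HasDerivAt g (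
    1 / 4 * ((1 - b ^ 2 / t ^ 2) * ((2 * B s * B1 s
        + 4 * (n - 1) / t * (B1 s * B1 s + B s * B2 s)
        + 4 / t * (B1 s ^ 2 + s * (2 * B1 s * B2 s)))
      + (2 * C s * C1 s - 4 * (n - 1) / t * (C1 s * C1 s + C s * C2 s)
        - 4 / t * (C1 s ^ 2 + s * (2 * C1 s * C2 s))))
      + 4 / t * (1 + b ^ 2 / t ^ 2) * ((B1 s * C1 s + B s * C2 s) - (B2 s * C s + B1 s * C1 s)))
    + 8 * b * (((B1 s - C1 s) / (2 * t) * ((B1 s - C1 s) / (2 * t))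
         + (B s - C s) / (2 * t) * ((B2 s - C2 s) / (2 * t)))
      - ((2 * ((B s - C s) / (2 * t)) * ((B1 s - C1 s) / (2 * t))) * (A1 s / A s)
        + ((B s - C s) / (2 * t)) ^ 2 * ((A2 s * A s - A1 s * A1 s) / A s ^ 2)))) s := by
    intro s hs
    rw [hg]
    have hz := ((dB s).sub (dC s)).div_const (2 * t)
    have hz1 := ((dB1 s).sub (dC1 s)).div_const (2 * t)
    have p1 := (((dB s).pow 2).add (((dB s).mul (dB1 s)).const_mul (4 * (n - 1) / t))).add
      (((hasDerivAt_id s).mul ((dB1 s).pow 2)).const_mul (4 / t))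
    have p2 := (((dC s).pow 2).sub (((dC s).mul (dC1 s)).const_mul (4 * (n - 1) / t))).sub
      (((hasDerivAt_id s).mul ((dC1 s).pow 2)).const_mul (4 / t))
    have p3 := (((dB s).mul (dC1 s)).sub ((dB1 s).mul (dC s))).const_mul
      (4 / t * (1 + b ^ 2 / t ^ 2))
    have p4 := ((hz.mul hz1).sub ((hz.pow 2).mul ((dA1 s).div (dA s) (Apos s hs).ne'))).const_mul
      (8 * b)
    have p5 := ((((p1.add p2).const_mul (1 - b ^ 2 / t ^ 2)).add p3).const_mul (1 / 4)).add p4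
    refine p5.congr_deriv ?_
    simp
  have hmain : 0 ≤ g 1 := by
    apply intfac_nonneg h.n_pos one_pos g _ (fun s hs => (hgd s hs).continuousAt.continuousWithinAt)
      (fun s hs => hgd s (Ioo_subset_Icc_self hs))
    intro s hs
    have hAs := (Apos s (Ioo_subset_Icc_self hs)).ne'
    have hs0 := hs.1
    have q : 0 ≤ ((B s + C s) / 2 - b * ((B s - C s) / (2 * t))) ^ 2
        + 8 * b * s * ((B1 s - C1 s) / (2 * t) - (B s - C s) / (2 * t) * (A1 s / A s)) ^ 2 := by
      have : 0 < b := by linarith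
      positivity
    refine q.trans_eq ?_
    rw [hg]
    have o1 := oB s
    have o2 := oC s
    have o3 := oA s
    have e1 : B2 s = (-n * B1 s - t * B s / 4) / s := by field_simp; linarith
    have e2 : C2 s = (-n * C1 s + t * C s / 4) / s := by field_simp; linarith
    have e3 : A2 s = (-n * A1 s - b * A s / 4) / s := by field_simp; linarith
    simp only [e1, e2, e3]
    field_simp
    ring
  rw [hg] at hmain
  simp only [eB, eC, eB1, eC1] at hmain
  have : ∀ x y : ℝ, 0 ≤ x → 4 * x = y → 0 ≤ y := fun x y hx e => by linarith
  refine this _ _ hmain ?_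
  field_simp
  ring

lemma bounds (h : BesselSys n a F F1 F2) {x : ℝ} (hx : 0 < x) (hxa : x < a) :
    Real.exp (x / (2 * n)) < F (-x) / F x ∧
      F (-x) / F x < ((a + x) / (a - x)) ^ (a / (4 * n)) := by
  have hn := h.n_pos
  have ha := h.a_pos
  obtain ⟨u, v, u', v', hu, hv, du, dv, ru, rv, u0, v0, vpos⟩ := h.exists_uv
  -- D > 0
  have hD : ∀ t, 0 < t → t < a → 0 < u t - v t := by
    intro t ht hta
    apply intfac_pos hn ht (fun s => u s - v s) (fun s => u' s - v' s)
    · intro s hs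
      exact ((du s (by linarith [hs.2])).sub
        (dv s (by linarith [hs.1]))).continuousAt.continuousWithinAt
    · intro s hs
      exact (du s (by linarith [hs.2])).sub (dv s (by linarith [hs.1]))
    · intro s hs
      have h1 := ru s (by linarith [hs.2])
      have h2 := rv s (by linarith [hs.1])
      have h3 := vpos s hs.1
      have h4 : 0 < s * (u s ^ 2 + v s ^ 2) := mul_pos hs.1 (by positivity)
      linarith
  -- S > 2 σ
  have hS : ∀ t, 0 < t → t < a → 1 / (2 * n) < u t + v t := by
    intro t ht hta
    have : 0 < u t + v t - 1 / (2 * n) := by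
      apply intfac_pos hn ht (fun s => u s + v s - 1 / (2 * n)) (fun s => u' s + v' s)
      · intro s hs
        exact (((du s (by linarith [hs.2])).add
          (dv s (by linarith [hs.1]))).sub_const _).continuousAt.continuousWithinAt
      · intro s hs
        exact ((du s (by linarith [hs.2])).add (dv s (by linarith [hs.1]))).sub_const _
      · intro s hs
        have h1 := ru s (by linarith [hs.2])
        have h2 := rv s (by linarith [hs.1])
        have h3 := vpos s hs.1
        have h5 := hD s hs.1 (by linarith [hs.2])
        have h4 : 0 < s * ((u s - v s) * (u s + v s)) :=
          mul_pos hs.1 (mul_pos h5 (by linarith))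
        have h6 : n * (1 / (2 * n)) = 1 / 2 := by field_simp
        linarith
    linarith
  -- P antitone
  have hPb : ∀ b, b < a → ∀ t, 0 < t → t < b → (b ^ 2 - t ^ 2) * (u t + v t) ≤ b ^ 2 / (2 * n) := by
    intro b hba t ht htb
    have dP : ∀ s, 0 ≤ s → s < a → HasDerivAt (fun s => (b ^ 2 - s ^ 2) * (u s + v s))
        ((-(2 * s)) * (u s + v s) + (b ^ 2 - s ^ 2) * (u' s + v' s)) s := by
      intro s h0 hsa
      have := (((hasDerivAt_id s).pow 2).const_sub (b ^ 2)).mul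
        ((du s hsa).add (dv s (by linarith)))
      refine this.congr_deriv ?_
      simp
    have anti : AntitoneOn (fun s => (b ^ 2 - s ^ 2) * (u s + v s)) (Icc 0 t) := by
      apply antitoneOn_of_deriv_nonpos (convex_Icc 0 t)
      · intro s hs
        exact (dP s hs.1 (by linarith [hs.2])).continuousAt.continuousWithinAt
      · rw [interior_Icc]
        intro s hs
        exact (dP s hs.1.le (by linarith [hs.2])).differentiableAt.differentiableWithinAt
      · rw [interior_Icc]
        intro s hs
        rw [(dP s hs.1.le (by linarith [hs.2])).deriv]
        have k := h.key hs.1 (by linarith [hs.2] : s < b) hba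
        rw [← hu, ← hv] at k
        have h1 := ru s (by linarith [hs.2])
        have h2 := rv s (by linarith [hs.1])
        have hs0 := hs.1
        have k2 := mul_nonneg (sq_nonneg s) k
        have k3 : (0:ℝ) ≤ -4 * s * ((-(2 * s)) * (u s + v s) + (b ^ 2 - s ^ 2) * (u' s + v' s)) := by
          refine k2.trans_eq ?_
          field_simp
          linear_combination (4 * (b ^ 2 - s ^ 2)) * (h1 + h2)
        by_contra hc
        push Not at hc
        nlinarith [mul_pos hs0 hc]
    have := anti (left_mem_Icc.2 ht.le) (right_mem_Icc.2 ht.le) ht.le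
    simp only [u0, v0] at this
    refine this.trans_eq ?_
    field_simp
    ring
  have hP : ∀ t, 0 < t → t < a → (a ^ 2 - t ^ 2) * (u t + v t) ≤ a ^ 2 / (2 * n) := by
    intro t ht hta
    have c1 : Filter.Tendsto (fun b : ℝ => (b ^ 2 - t ^ 2) * (u t + v t)) (nhdsWithin a (Iio a))
        (nhds ((a ^ 2 - t ^ 2) * (u t + v t))) :=
      (Continuous.tendsto (by fun_prop) a).mono_left nhdsWithin_le_nhds
    have c2 : Filter.Tendsto (fun b : ℝ => b ^ 2 / (2 * n)) (nhdsWithin a (Iio a))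
        (nhds (a ^ 2 / (2 * n))) :=
      (Continuous.tendsto (by fun_prop) a).mono_left nhdsWithin_le_nhds
    refine le_of_tendsto_of_tendsto c1 c2 ?_
    filter_upwards [Ioo_mem_nhdsLT hta] with b hb
    exact hPb b hb.2 t ht hb.1
  -- log derivative
  have dL : ∀ s, 0 ≤ s → s < a →
      HasDerivAt (fun s => Real.log (F (-s)) - Real.log (F s)) (u s + v s) s := by
    intro s h0 hsa
    have p1 := h.pos s hsa
    have p2 := h.pos (-s) (by linarith)
    have := (((h.d0 (-s)).comp s (hasDerivAt_neg s)).log p2.ne').sub ((h.d0 s).log p1.ne')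
    refine this.congr_deriv ?_
    rw [hu, hv]
    simp only [Function.comp]
    ring
  have px := h.pos x hxa
  have pmx := h.pos (-x) (by linarith)
  have hlog : Real.log (F (-x) / F x) = Real.log (F (-x)) - Real.log (F x) :=
    Real.log_div pmx.ne' px.ne'
  constructor
  · rw [← Real.lt_log_iff_exp_lt (div_pos pmx px), hlog]
    have d2 : ∀ s, 0 ≤ s → s < a → HasDerivAt
        (fun s => Real.log (F (-s)) - Real.log (F s) - s * (1 / (2 * n)))
        (u s + v s - 1 / (2 * n)) s := by
      intro s h0 hsa
      refine ((dL s h0 hsa).sub ((hasDerivAt_id s).mul_const (1 / (2 * n)))).congr_deriv ?_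
      simp
    have mono : StrictMonoOn (fun s => Real.log (F (-s)) - Real.log (F s) - s * (1 / (2 * n)))
        (Icc 0 x) := by
      apply strictMonoOn_of_deriv_pos (convex_Icc 0 x)
      · intro s hs
        exact (d2 s hs.1 (by linarith [hs.2])).continuousAt.continuousWithinAt
      · rw [interior_Icc]
        intro s hs
        rw [(d2 s hs.1.le (by linarith [hs.2])).deriv]
        have := hS s hs.1 (by linarith [hs.2])
        linarith
    have := mono (left_mem_Icc.2 hx.le) (right_mem_Icc.2 hx.le) hx
    simp only [neg_zero, sub_self, zero_mul] at this
    rw [div_eq_mul_one_div]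
    linarith
  · have hq : 0 < (a + x) / (a - x) := div_pos (by linarith) (by linarith)
    rw [← Real.log_lt_log_iff (div_pos pmx px) (Real.rpow_pos_of_pos hq _), Real.log_rpow hq, hlog,
      Real.log_div (by linarith) (by linarith)]
    obtain ⟨Ψ, hΨ⟩ : ∃ Ψ : ℝ → ℝ, Ψ = fun s => a / (4 * n) * (Real.log (a + s) - Real.log (a - s)) -
      (Real.log (F (-s)) - Real.log (F s)) := ⟨_, rfl⟩
    have d3 : ∀ s, 0 ≤ s → s < a → HasDerivAt Ψ
        (a ^ 2 / (2 * n) / (a ^ 2 - s ^ 2) - (u s + v s)) s := by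
      intro s h0 hsa
      have q1 : a + s ≠ 0 := by linarith
      have q2 : a - s ≠ 0 := by linarith
      have q3 : a ^ 2 - s ^ 2 ≠ 0 := by
        have : a ^ 2 - s ^ 2 = (a + s) * (a - s) := by ring
        rw [this]; exact mul_ne_zero q1 q2
      rw [hΨ]
      refine ((((((hasDerivAt_id s).const_add a).log q1).sub
        (((hasDerivAt_id s).const_sub a).log q2)).const_mul (a / (4 * n))).sub
          (dL s h0 hsa)).congr_deriv ?_
      have e : a ^ 2 - s ^ 2 = (a + s) * (a - s) := by ring
      rw [e]
      simp only [id]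
      field_simp
      ring
    have mono : MonotoneOn Ψ (Icc 0 x) := by
      apply monotoneOn_of_deriv_nonneg (convex_Icc 0 x)
      · intro s hs
        exact (d3 s hs.1 (by linarith [hs.2])).continuousAt.continuousWithinAt
      · rw [interior_Icc]
        intro s hs
        exact (d3 s hs.1.le (by linarith [hs.2])).differentiableAt.differentiableWithinAt
      · rw [interior_Icc]
        intro s hs
        rw [(d3 s hs.1.le (by linarith [hs.2])).deriv]
        have := hP s hs.1 (by linarith [hs.2])
        have q : 0 < a ^ 2 - s ^ 2 := by nlinarith [hs.1, hs.2]
        rw [sub_nonneg, le_div_iff₀ q]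
        linarith
    have Ψ0 : Ψ 0 = 0 := by rw [hΨ]; simp
    suffices hh : 0 < Ψ x by
      rw [hΨ] at hh
      linarith
    by_contra hneg
    push Not at hneg
    have Ψz : ∀ s ∈ Icc 0 x, Ψ s = 0 := by
      intro s hs
      apply le_antisymm
      · exact (mono hs (right_mem_Icc.2 hx.le) hs.2).trans hneg
      · rw [← Ψ0]; exact mono (left_mem_Icc.2 hx.le) hs hs.1
    have Seq : ∀ s ∈ Ioo 0 x, u s + v s = a ^ 2 / (2 * n) / (a ^ 2 - s ^ 2) := by
      intro s hs
      have e : Ψ =ᶠ[nhds s] fun _ => 0 := by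
        filter_upwards [Ioo_mem_nhds hs.1 hs.2] with r hr
        exact Ψz r (Ioo_subset_Icc_self hr)
      have := ((d3 s hs.1.le (by linarith [hs.2])).congr_of_eventuallyEq e.symm).unique
        (hasDerivAt_const s (0:ℝ))
      linarith
    have Qpos : ∀ s ∈ Ioo 0 x, 0 < a ^ 2 - s ^ 2 := fun s hs => by nlinarith [hs.1, hs.2]
    have S'eq : ∀ s ∈ Ioo 0 x, u' s + v' s = a ^ 2 / (2 * n) * (2 * s) / (a ^ 2 - s ^ 2) ^ 2 := by
      intro s hs
      have hQ := Qpos s hs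
      have e : (fun r => u r + v r) =ᶠ[nhds s] fun r => a ^ 2 / (2 * n) / (a ^ 2 - r ^ 2) := by
        filter_upwards [Ioo_mem_nhds hs.1 hs.2] with r hr
        exact Seq r hr
      have q1 := (du s (by linarith [hs.2])).add (dv s (by linarith [hs.1]))
      have q2 := (hasDerivAt_const s (a ^ 2 / (2 * n))).div
        (((hasDerivAt_id s).pow 2).const_sub (a ^ 2)) hQ.ne'
      have := (q1.congr_of_eventuallyEq e.symm).unique q2
      rw [this]
      simp
    have Deq : ∀ s ∈ Ioo 0 x, u s - v s = 2 * s / (a ^ 2 - s ^ 2) + n * s / a ^ 2 := by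
      intro s hs
      have hQ := Qpos s hs
      have hs0 := hs.1
      have h1 := ru s (by linarith [hs.2])
      have h2 := rv s (by linarith [hs.1])
      have e1 : s * (u' s + v' s) = s * ((u s - v s) * (u s + v s)) - n * (u s + v s) + 1 / 2 := by
        linear_combination h1 + h2
      rw [S'eq s hs, Seq s hs] at e1
      generalize u s - v s = D at *
      have hQ' := hQ.ne'
      field_simp at e1 ⊢
      have := hs0.ne'
      apply mul_left_cancel₀ this
      linear_combination (-1) * e1
    have D'eq : ∀ s ∈ Ioo 0 x, u' s - v' s =
        2 / (a ^ 2 - s ^ 2) + 4 * s ^ 2 / (a ^ 2 - s ^ 2) ^ 2 + n / a ^ 2 := by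
      intro s hs
      have hQ := Qpos s hs
      have e : (fun r => u r - v r) =ᶠ[nhds s]
          fun r => 2 * r / (a ^ 2 - r ^ 2) + n * r / a ^ 2 := by
        filter_upwards [Ioo_mem_nhds hs.1 hs.2] with r hr
        exact Deq r hr
      have q1 := (du s (by linarith [hs.2])).sub (dv s (by linarith [hs.1]))
      have q2 := (((hasDerivAt_id s).const_mul 2).div
        (((hasDerivAt_id s).pow 2).const_sub (a ^ 2)) hQ.ne').add
        (((hasDerivAt_id s).const_mul n).div_const (a ^ 2))
      have := (q1.congr_of_eventuallyEq e.symm).unique q2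
      rw [this]
      have hQ' := hQ.ne'
      simp
      field_simp
      ring
    have poly : ∀ s ∈ Ioo 0 x,
        2 * (2 * (a ^ 2 - s ^ 2) + 4 * s ^ 2 + (n + n ^ 2) / a ^ 2 * (a ^ 2 - s ^ 2) ^ 2
          + 2 * n * (a ^ 2 - s ^ 2)) =
        (a ^ 2 / (2 * n)) ^ 2 + (2 * s + n * s / a ^ 2 * (a ^ 2 - s ^ 2)) ^ 2 := by
      intro s hs
      have hQ := Qpos s hs
      have hs0 := hs.1
      have h1 := ru s (by linarith [hs.2])
      have h2 := rv s (by linarith [hs.1])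
      have e1 : 2 * (s * (u' s - v' s)) =
          s * ((u s + v s) ^ 2 + (u s - v s) ^ 2) - 2 * n * (u s - v s) := by
        linear_combination 2 * h1 - 2 * h2
      rw [D'eq s hs, Seq s hs, Deq s hs] at e1
      have hQ' := hQ.ne'
      have := hs0.ne'
      apply mul_left_cancel₀ this
      field_simp at e1 ⊢
      linear_combination e1
    have polyT : ∀ T, 0 < T → T < x ^ 2 →
        2 * (2 * (a ^ 2 - T) + 4 * T + (n + n ^ 2) / a ^ 2 * (a ^ 2 - T) ^ 2
          + 2 * n * (a ^ 2 - T)) =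
        (a ^ 2 / (2 * n)) ^ 2 + T * (2 + n / a ^ 2 * (a ^ 2 - T)) ^ 2 := by
      intro T hT hTx
      have hs : Real.sqrt T ∈ Ioo 0 x := ⟨Real.sqrt_pos.2 hT, (Real.sqrt_lt' hx).2 hTx⟩
      have := poly _ hs
      rw [Real.sq_sqrt hT.le] at this
      have e := Real.sq_sqrt hT.le
      rw [this]
      linear_combination (2 + n / a ^ 2 * (a ^ 2 - T)) ^ 2 * e
    have hx2 : 0 < x ^ 2 := by positivity
    have k1 := polyT (x ^ 2 / 8) (by linarith) (by linarith)
    have k2 := polyT (2 * (x ^ 2 / 8)) (by linarith) (by linarith)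
    have k3 := polyT (3 * (x ^ 2 / 8)) (by linarith) (by linarith)
    have k4 := polyT (4 * (x ^ 2 / 8)) (by linarith) (by linarith)
    have hz : 6 * (x ^ 2 / 8) ^ 3 * (n / a ^ 2) ^ 2 = 0 := by
      linear_combination -k4 + 3 * k3 - 3 * k2 + k1
    have : 0 < 6 * (x ^ 2 / 8) ^ 3 * (n / a ^ 2) ^ 2 := by positivity
    linarith

end BesselSys

/-- exponential generating function -/
noncomputable def egf (d : ℕ → ℝ) (t : ℝ) : ℝ := ∑' k : ℕ, d k * t ^ k / (k.factorial : ℝ)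

lemma egf_summable {d : ℕ → ℝ} {K r : ℝ} (hd : ∀ k, |d k| ≤ K * r ^ k) (t : ℝ) :
    Summable fun k : ℕ => d k * t ^ k / (k.factorial : ℝ) := by
  refine Summable.of_norm_bounded ((Real.summable_pow_div_factorial (r * |t|)).mul_left K) ?_
  intro k
  rw [Real.norm_eq_abs, abs_div, abs_mul, abs_pow, Nat.abs_cast, mul_pow, ← mul_div_assoc,
    ← mul_assoc]
  gcongr
  exact hd k

lemma egf_hasDerivAt {d : ℕ → ℝ} {K r : ℝ} (hr : 0 ≤ r) (hd : ∀ k, |d k| ≤ K * r ^ k) (t : ℝ) :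
    HasDerivAt (egf d) (egf (fun k => d (k + 1)) t) t := by
  have hK : 0 ≤ K := by simpa using (abs_nonneg _).trans (hd 0)
  have hd' : ∀ k, |d (k + 1)| ≤ (K * r) * r ^ k := fun k => (hd (k + 1)).trans_eq (by ring)
  have hg : ∀ (k : ℕ) (y : ℝ), HasDerivAt (fun y => d (k + 1) * y ^ (k + 1) / ((k + 1).factorial : ℝ))
      (d (k + 1) * y ^ k / (k.factorial : ℝ)) y := by
    intro k y
    refine (((hasDerivAt_pow (k + 1) y).const_mul (d (k + 1))).div_const _).congr_deriv ?_
    rw [Nat.factorial_succ]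
    have : (k.factorial : ℝ) ≠ 0 := by positivity
    have : ((k : ℝ) + 1) ≠ 0 := by positivity
    push_cast
    field_simp
  have main := hasDerivAt_tsum_of_isPreconnected (y := t) (y₀ := t)
    (u := fun k : ℕ => (K * r) * ((r * (|t| + 1)) ^ k / (k.factorial : ℝ)))
    (t := Metric.ball (0 : ℝ) (|t| + 1))
    ((Real.summable_pow_div_factorial _).mul_left _) Metric.isOpen_ball
    (convex_ball _ _).isPreconnected (fun k y _ => hg k y) ?_ (by simp) ?_ (by simp)
  · have e : egf d = fun y => d 0 + ∑' k : ℕ, d (k + 1) * y ^ (k + 1) / ((k + 1).factorial : ℝ) := by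
      funext y
      unfold egf
      rw [(egf_summable hd y).tsum_eq_zero_add]
      simp
    rw [e]
    exact main.const_add _
  · intro k y hy
    rw [Real.norm_eq_abs, abs_div, abs_mul, abs_pow, Nat.abs_cast, mul_pow, ← mul_div_assoc,
      ← mul_assoc]
    have : |y| ≤ |t| + 1 := by
      have := mem_ball_zero_iff.1 hy
      exact this.le
    have h2 := hd' k
    gcongr
  · exact (summable_nat_add_iff 1).2 (egf_summable hd t)

/-- coefficients of the normalized Bessel function -/
noncomputable def bco (n : ℝ) (k : ℕ) : ℝ := (-1) ^ k * Real.Gamma n / (4 ^ k * Real.Gamma (n + k))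

lemma bco_succ {n : ℝ} (hn : 0 < n) (k : ℕ) : bco n k / 4 + (n + k) * bco n (k + 1) = 0 := by
  unfold bco
  have hk : 0 < n + k := by positivity
  have e : n + ((k + 1 : ℕ) : ℝ) = (n + k) + 1 := by push_cast; ring
  rw [e, Real.Gamma_add_one hk.ne']
  have := (Real.Gamma_pos_of_pos hk).ne'
  have := hk.ne'
  field_simp
  ring

lemma bco_bound {n : ℝ} (hn : 0 < n) (k : ℕ) : |bco n k| ≤ 1 * (1 / (4 * n)) ^ k := by
  induction k with
  | zero => simp [bco, (Real.Gamma_pos_of_pos hn).ne']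
  | succ k ih =>
    have hk : 0 < n + k := by positivity
    have h := bco_succ hn k
    have e : bco n (k + 1) = -(bco n k * (1 / (4 * (n + k)))) := by
      field_simp
      linarith
    rw [e, abs_neg, abs_mul, pow_succ, ← mul_assoc]
    have h1 : |1 / (4 * (n + k))| ≤ 1 / (4 * n) := by
      rw [abs_of_pos (by positivity)]
      gcongr
      simp
    gcongr

lemma bco_ode {n : ℝ} (hn : 0 < n) (t : ℝ) :
    t * egf (fun k => bco n (k + 1 + 1)) t + n * egf (fun k => bco n (k + 1)) t
      + egf (bco n) t / 4 = 0 := by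
  have b0 := bco_bound hn
  have b1 : ∀ k, |bco n (k + 1)| ≤ (1 / (4 * n)) * (1 / (4 * n)) ^ k :=
    fun k => (b0 (k + 1)).trans_eq (by ring)
  have b2 : ∀ k, |bco n (k + 1 + 1)| ≤ (1 / (4 * n)) ^ 2 * (1 / (4 * n)) ^ k :=
    fun k => (b0 (k + 1 + 1)).trans_eq (by ring)
  have s0 := (egf_summable b0 t).hasSum
  have s1 := (egf_summable b1 t).hasSum
  have s2 := (egf_summable b2 t).hasSum
  have s3 : HasSum (fun k : ℕ => k * (bco n (k + 1) * t ^ k / (k.factorial : ℝ)))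
      (t * egf (fun k => bco n (k + 1 + 1)) t) := by
    rw [← hasSum_nat_add_iff' 1]
    simp only [Finset.range_one, Finset.sum_singleton, Nat.cast_zero, zero_mul, sub_zero]
    refine (s2.mul_left t).congr_fun ?_
    intro k
    rw [Nat.factorial_succ]
    have : (k.factorial : ℝ) ≠ 0 := by positivity
    have : ((k : ℝ) + 1) ≠ 0 := by positivity
    push_cast
    field_simp
    ring
  have s := (s3.add (s1.mul_left n)).add (s0.div_const 4)
  refine s.unique ?_
  convert hasSum_zero with k
  linear_combination (t ^ k / (k.factorial : ℝ)) * bco_succ hn k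

lemma bco_neg_pos {n : ℝ} (hn : 0 < n) {t : ℝ} (ht : t ≤ 0) : 0 < egf (bco n) t := by
  have e : ∀ k, bco n k * t ^ k = (Real.Gamma n / (4 ^ k * Real.Gamma (n + k))) * (-t) ^ k := by
    intro k
    unfold bco
    rw [neg_pow]
    ring
  have hΓ : ∀ k : ℕ, 0 < Real.Gamma (n + k) := fun k => Real.Gamma_pos_of_pos (by positivity)
  have hG := Real.Gamma_pos_of_pos hn
  have ht' : 0 ≤ -t := by linarith
  refine (egf_summable (bco_bound hn) t).tsum_pos (fun k => ?_) 0 ?_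
  · rw [e]
    have := hΓ k
    positivity
  · simp [bco, hG.ne']

lemma bco_zero_val {n : ℝ} (hn : 0 < n) : egf (bco n) 0 = 1 := by
  unfold egf
  rw [tsum_eq_single 0]
  · simp [bco, (Real.Gamma_pos_of_pos hn).ne']
  · intro k hk
    simp [hk]

lemma Jcal_eq (ν x : ℝ) : Jcal ν x = egf (bco (ν + 1)) (x ^ 2) := by
  unfold Jcal egf bco
  congr 1
  funext k
  have e : ν + (k : ℝ) + 1 = ν + 1 + k := by ring
  rw [e, pow_mul, pow_mul]
  norm_num
  ring

lemma half_rpow {ν x : ℝ} (hx : 0 < x) (k : ℕ) :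
    (x / 2) ^ (ν + 2 * (k : ℝ)) = (x / 2) ^ ν * ((x ^ 2) ^ k / 4 ^ k) := by
  have hx2 : 0 < x / 2 := by positivity
  rw [Real.rpow_add hx2]
  congr 1
  have : (2 * (k : ℝ)) = ((2 * k : ℕ) : ℝ) := by push_cast; ring
  rw [this, Real.rpow_natCast, pow_mul, div_pow, div_pow]
  norm_num

lemma besselJ_eq {ν x : ℝ} (hν : -1 < ν) (hx : 0 < x) :
    besselJ ν x = (x / 2) ^ ν / Real.Gamma (ν + 1) * egf (bco (ν + 1)) (x ^ 2) := by
  unfold besselJ egf bco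
  rw [← tsum_mul_left]
  congr 1
  funext k
  have e : ν + (k : ℝ) + 1 = ν + 1 + k := by ring
  have hn : 0 < ν + 1 := by linarith
  have := (Real.Gamma_pos_of_pos hn).ne'
  rw [e, half_rpow hx]
  field_simp

lemma besselI_eq {ν x : ℝ} (hν : -1 < ν) (hx : 0 < x) :
    besselI ν x = (x / 2) ^ ν / Real.Gamma (ν + 1) * egf (bco (ν + 1)) (-(x ^ 2)) := by
  unfold besselI egf bco
  rw [← tsum_mul_left]
  congr 1
  funext k
  have e : ν + (k : ℝ) + 1 = ν + 1 + k := by ring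
  have hn : 0 < ν + 1 := by linarith
  have := (Real.Gamma_pos_of_pos hn).ne'
  have h1 : ((-1 : ℝ) ^ k) * (-1) ^ k = 1 := by rw [← mul_pow]; simp
  rw [e, half_rpow hx, neg_pow (x ^ 2)]
  have h2 : ∀ p q : ℝ, (-1) ^ k * p * ((-1) ^ k * q) = p * q := fun p q => by
    linear_combination p * q * h1
  have h3 : (-1) ^ k * Real.Gamma (ν + 1) / (4 ^ k * Real.Gamma (ν + 1 + k)) *
      ((-1) ^ k * (x ^ 2) ^ k) =
      Real.Gamma (ν + 1) * (x ^ 2) ^ k / (4 ^ k * Real.Gamma (ν + 1 + k)) := by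
    rw [div_mul_eq_mul_div, h2]
  rw [h3]
  field_simp

/-- Bounds for the ratio `I_ν(x)/J_ν(x)` on `(0, j_{ν,1})`. -/
theorem besselI_div_besselJ_bounds (ν : ℝ) (hν : -1 < ν) (j1 : ℝ)
    (hj1pos : 0 < j1) (hj1zero : Jcal ν j1 = 0)
    (hj1min : ∀ x : ℝ, 0 < x → Jcal ν x = 0 → j1 ≤ x) :
    ∀ x : ℝ, 0 < x → x < j1 →
      Real.exp (x ^ 2 / (2 * (ν + 1))) < besselI ν x / besselJ ν x ∧
      besselI ν x / besselJ ν x <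
        ((j1 ^ 2 + x ^ 2) / (j1 ^ 2 - x ^ 2)) ^ (j1 ^ 2 / (4 * (ν + 1))) := by
  have hn : 0 < ν + 1 := by linarith
  have b0 := bco_bound hn
  have b1 : ∀ k, |bco (ν + 1) (k + 1)| ≤ (1 / (4 * (ν + 1))) * (1 / (4 * (ν + 1))) ^ k :=
    fun k => (b0 (k + 1)).trans_eq (by ring)
  have hr : 0 ≤ 1 / (4 * (ν + 1)) := by positivity
  have sys : BesselSys (ν + 1) (j1 ^ 2) (egf (bco (ν + 1)))
      (egf fun k => bco (ν + 1) (k + 1)) (egf fun k => bco (ν + 1) (k + 1 + 1)) := by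
    refine ⟨hn, by positivity, egf_hasDerivAt hr b0, egf_hasDerivAt hr b1, bco_ode hn,
      bco_zero_val hn, ?_⟩
    intro t ht
    rcases le_or_gt t 0 with h0 | h0
    · exact bco_neg_pos hn h0
    · by_contra hc
      push Not at hc
      have hcont : Continuous (egf (bco (ν + 1))) :=
        continuous_iff_continuousAt.2 fun t => (egf_hasDerivAt hr b0 t).continuousAt
      have hmem : (0 : ℝ) ∈ Icc (egf (bco (ν + 1)) t) (egf (bco (ν + 1)) 0) :=
        ⟨hc, by rw [bco_zero_val hn]; exact zero_le_one⟩
      obtain ⟨s, hs, hs0⟩ := intermediate_value_Icc' h0.le hcont.continuousOn hmem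
      have hspos : 0 < s := by
        rcases hs.1.lt_or_eq with h | h
        · exact h
        · rw [← h, bco_zero_val hn] at hs0
          norm_num at hs0
      have hj := hj1min (Real.sqrt s) (Real.sqrt_pos.2 hspos)
        (by rw [Jcal_eq, Real.sq_sqrt hspos.le, hs0])
      have h2 : j1 ^ 2 ≤ s := by
        rw [← Real.sq_sqrt hspos.le]
        gcongr
      linarith [hs.2]
  intro x hx hxj
  have hb := sys.bounds (x := x ^ 2) (by positivity) (by gcongr)
  have hΓ := Real.Gamma_pos_of_pos hn
  have hc : (x / 2) ^ ν / Real.Gamma (ν + 1) ≠ 0 :=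
    (div_pos (Real.rpow_pos_of_pos (by positivity) _) hΓ).ne'
  have e : besselI ν x / besselJ ν x =
      egf (bco (ν + 1)) (-(x ^ 2)) / egf (bco (ν + 1)) (x ^ 2) := by
    rw [besselI_eq hν hx, besselJ_eq hν hx, mul_div_mul_left _ _ hc]
  rw [e]
  exact hb
end

section
/- Let ν > -1. Then the zeros of 𝒟_ν' are interlaced with those of 𝒟_ν: 𝒟_ν' has no zero in the interval (0, α_{ν,1}], and for every n ≥ 1 the derivative 𝒟_ν' has exactly one zero in the open interval (α_{ν,n}, α_{ν,n+1}). -/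
open Real Set

lemma hd_congr {f g : ℝ → ℝ} {f' g' x : ℝ} (h : HasDerivAt f f' x) (h1 : ∀ t, g t = f t)
    (h2 : g' = f') : HasDerivAt g g' x := by
  have : g = f := funext h1
  rw [this, h2]; exact h

lemma hdw_congr {f g : ℝ → ℝ} {f' g' x : ℝ} {S : Set ℝ} (h : HasDerivWithinAt f f' S x)
    (h1 : ∀ t, g t = f t) (h2 : g' = f') : HasDerivWithinAt g g' S x := by
  have : g = f := funext h1
  rw [this, h2]; exact h

lemma hs_congr {f g : ℕ → ℝ} {a : ℝ} (h : HasSum f a) (h1 : ∀ n, g n = f n) : HasSum g a := by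
  have : g = f := funext h1
  rw [this]; exact h

noncomputable def PSer (a : ℕ → ℝ) (s : ℝ) : ℝ := ∑' n : ℕ, a n * s ^ n

def PBd (a : ℕ → ℝ) : Prop := ∃ C : ℝ, ∀ n, |a n| * (n.factorial : ℝ) ≤ C

def PDer (a : ℕ → ℝ) (n : ℕ) : ℝ := ((n : ℝ) + 1) * a (n + 1)

lemma PBd.der {a : ℕ → ℝ} (h : PBd a) : PBd (PDer a) := by
  obtain ⟨C, hC⟩ := h
  refine ⟨C, fun n => ?_⟩
  have := hC (n + 1)
  rw [Nat.factorial_succ] at this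
  push_cast at this
  rw [PDer, abs_mul, abs_of_nonneg (by positivity : (0:ℝ) ≤ (n:ℝ) + 1)]
  linarith

lemma PBd.summable_abs {a : ℕ → ℝ} (h : PBd a) (r : ℝ) (hr : 0 ≤ r) :
    Summable (fun n => |a n| * r ^ n) := by
  obtain ⟨C, hC⟩ := h
  refine Summable.of_nonneg_of_le (fun n => by positivity) (fun n => ?_)
    ((Real.summable_pow_div_factorial r).mul_left C)
  have hf : (0:ℝ) < (n.factorial : ℝ) := by positivity
  have : |a n| ≤ C / (n.factorial : ℝ) := by
    rw [le_div_iff₀ hf]; exact hC n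
  calc |a n| * r ^ n ≤ C / (n.factorial : ℝ) * r ^ n := by gcongr
    _ = _ := by ring

lemma PBd.summable {a : ℕ → ℝ} (h : PBd a) (s : ℝ) : Summable (fun n => a n * s ^ n) := by
  apply Summable.of_norm
  simpa [abs_mul, abs_pow] using h.summable_abs |s| (abs_nonneg s)

lemma PBd.shift {a : ℕ → ℝ} (h : PBd a) (s : ℝ) :
    HasSum (fun n : ℕ => (n : ℝ) * a n * s ^ n) (s * PSer (PDer a) s) := by
  have h1 := ((h.der.summable s).hasSum).mul_left s
  rw [← hasSum_nat_add_iff' 1]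
  simp only [Finset.range_one, Finset.sum_singleton, Nat.cast_zero, zero_mul, sub_zero]
  refine hs_congr h1 (fun n => ?_)
  simp only [PDer]; push_cast; ring

lemma PBd.hasDerivAt {a : ℕ → ℝ} (h : PBd a) (s : ℝ) :
    HasDerivAt (PSer a) (PSer (PDer a) s) s := by
  set R := |s| + 1 with hR
  have hR0 : 0 ≤ R := by positivity
  have hsum : Summable (fun n : ℕ => (n : ℝ) * |a n| * R ^ (n - 1)) := by
    rw [← summable_nat_add_iff 1]
    refine (h.der.summable_abs R hR0).congr (fun n => ?_)
    rw [PDer, abs_mul, abs_of_nonneg (by positivity : (0:ℝ) ≤ (n:ℝ) + 1)]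
    push_cast; simp
  have key := hasDerivAt_tsum_of_isPreconnected (𝕜 := ℝ) (t := Metric.ball (0:ℝ) R)
    (g := fun n t => a n * t ^ n) (g' := fun n t => a n * ((n : ℝ) * t ^ (n - 1)))
    (y₀ := 0) (y := s) hsum Metric.isOpen_ball (convex_ball _ _).isPreconnected
    (fun n t _ => (hasDerivAt_pow n t).const_mul _)
    (fun n t ht => by
      have ht' : |t| ≤ R := by simpa using (Metric.mem_ball.1 ht).le
      rw [norm_mul, norm_mul, norm_pow]
      simp only [Real.norm_eq_abs, Nat.abs_cast]
      have : |t| ^ (n-1) ≤ R ^ (n-1) := by gcongr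
      calc |a n| * ((n:ℝ) * |t| ^ (n-1)) ≤ |a n| * ((n:ℝ) * R ^ (n-1)) := by gcongr
        _ = _ := by ring)
    (by simp; positivity) (h.summable 0) (by simp [hR])
  have e : PSer (PDer a) s = ∑' n : ℕ, a n * ((n : ℝ) * s ^ (n - 1)) := by
    have hs : HasSum (fun n : ℕ => a n * ((n : ℝ) * s ^ (n - 1))) (PSer (PDer a) s) := by
      rw [← hasSum_nat_add_iff' 1]
      simp only [Finset.range_one, Finset.sum_singleton, Nat.cast_zero, zero_mul, mul_zero, sub_zero]
      refine hs_congr (h.der.summable s).hasSum (fun n => ?_)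
      simp only [PDer, Nat.add_sub_cancel]; push_cast; ring
    exact hs.tsum_eq.symm
  rw [e]
  exact key

lemma PSer_zero (a : ℕ → ℝ) : PSer a 0 = a 0 := by
  rw [PSer, tsum_eq_single 0]
  · simp
  · intro n hn; simp [hn]

noncomputable def cf (ν : ℝ) (n : ℕ) : ℝ :=
  (-1 : ℝ) ^ n * Real.Gamma (ν + 1) / ((2 : ℝ) ^ (2 * n) * (n.factorial : ℝ) * Real.Gamma (ν + n + 1))

lemma cf_zero (ν : ℝ) (hν : -1 < ν) : cf ν 0 = 1 := by
  have : Real.Gamma (ν + 1) ≠ 0 := (Real.Gamma_pos_of_pos (by linarith)).ne'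
  simp [cf, this]

lemma cf_rec (ν : ℝ) (hν : -1 < ν) (n : ℕ) :
    4 * ((n : ℝ) + 1) * (ν + n + 1) * cf ν (n + 1) = - cf ν n := by
  have hn : 0 < ν + n + 1 := by have := n.cast_nonneg (α := ℝ); linarith
  have hG : Real.Gamma (ν + n + 1) ≠ 0 := (Real.Gamma_pos_of_pos hn).ne'
  have h1 : Real.Gamma (ν + ((n + 1 : ℕ) : ℝ) + 1) = (ν + n + 1) * Real.Gamma (ν + n + 1) := by
    rw [← Real.Gamma_add_one hn.ne']; push_cast; ring_nf
  have hf : (n.factorial : ℝ) ≠ 0 := by positivity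
  have hn1 : (n : ℝ) + 1 ≠ 0 := by positivity
  simp only [cf]
  rw [h1, Nat.factorial_succ, show 2 * (n + 1) = 2 * n + 2 by ring, pow_add, pow_succ (-1 : ℝ)]
  push_cast
  have := hn.ne'
  field_simp
  ring

lemma cf_bd (ν : ℝ) (hν : -1 < ν) : PBd (cf ν) := by
  have h0 : 0 < ν + 1 := by linarith
  refine ⟨1 + 1 / (ν + 1), fun n => ?_⟩
  induction n with
  | zero => rw [cf_zero ν hν]; simp; linarith
  | succ n ih =>
    have hn : 0 < ν + n + 1 := by have := n.cast_nonneg (α := ℝ); linarith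
    have hr := congrArg abs (cf_rec ν hν n)
    rw [abs_neg, abs_mul, abs_of_pos (by positivity)] at hr
    rw [← hr] at ih
    rw [Nat.factorial_succ]; push_cast
    set X := |cf ν (n + 1)| * ((n + 1 : ℝ) * (n.factorial : ℝ)) with hX
    have hX0 : 0 ≤ X := by positivity
    have ih' : 4 * (ν + n + 1) * X ≤ 1 + 1 / (ν + 1) := by
      rw [hX]; linarith
    rcases Nat.eq_zero_or_pos n with h | h
    · subst h
      have h2 : 4 * (ν + 1) * X = 1 := by
        have := cf_zero ν hν
        rw [hX]; simp [this] at hr ⊢; linarith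
      have : X = 1 / (ν + 1) / 4 := by field_simp; linarith
      have : 0 < 1 / (ν + 1) := by positivity
      linarith
    · have : (1:ℝ) ≤ n := by exact_mod_cast h
      nlinarith

section ode
variable {ν : ℝ} {U Y Z : ℝ → ℝ}

lemma e_pos (hν : -1 < ν) (hU : ∀ s, HasDerivAt U (Y s) s) (hY : ∀ s, HasDerivAt Y (Z s) s)
    (hode : ∀ s, 4 * s * Z s + 4 * (ν + 1) * Y s + U s = 0) (hU0 : U 0 = 1)
    (s : ℝ) (hs : 0 ≤ s) : 0 < 4 * s * Y s ^ 2 + 4 * ν * U s * Y s + U s ^ 2 := by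
  set e : ℝ → ℝ := fun s => 4 * s * Y s ^ 2 + 4 * ν * U s * Y s + U s ^ 2 with he
  have hUc : Continuous U := continuous_iff_continuousAt.2 fun s => (hU s).continuousAt
  have hYc : Continuous Y := continuous_iff_continuousAt.2 fun s => (hY s).continuousAt
  have hec : Continuous e := by simp only [he]; fun_prop
  have hν1 : 0 < ν + 1 := by linarith
  have he0 : 0 < e 0 := by
    have h := hode 0
    rw [hU0] at h
    have hY0 : Y 0 = -1 / (4 * (ν + 1)) := by field_simp; linarith
    have : e 0 = 1 / (ν + 1) := by
      simp only [he, hU0, hY0]; field_simp; ring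
    rw [this]; positivity
  have hmono : MonotoneOn (fun s => s ^ (ν + 1) * e s) (Set.Ici 0) := by
    apply monotoneOn_of_hasDerivWithinAt_nonneg (f' := fun s => s ^ ν * U s ^ 2) (convex_Ici 0)
    · exact ((Real.continuous_rpow_const hν1.le).mul hec).continuousOn
    · intro x hx
      rw [interior_Ici] at hx
      have hx' : 0 < x := hx
      have h1 := Real.hasDerivAt_rpow_const (x := x) (p := ν + 1) (Or.inl hx'.ne')
      have h2 : HasDerivAt e (4 * Y x ^ 2 + 8 * x * Y x * Z x + 4 * ν * (Y x * Y x + U x * Z x)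
          + 2 * U x * Y x) x := by
        have := (((hasDerivAt_id x).const_mul 4).mul ((hY x).pow 2)).add
          (((hU x).mul (hY x)).const_mul (4 * ν)) |>.add ((hU x).pow 2)
        refine hd_congr this (fun t => ?_) ?_
        · simp [he]; ring
        · simp; ring
      have h3 := (h1.mul h2).hasDerivWithinAt (s := interior (Set.Ici 0))
      refine hdw_congr h3 (fun t => rfl) ?_
      rw [show ν + 1 - 1 = ν by ring, Real.rpow_add_one hx'.ne']
      have h4 : 4 * x * Z x = - 4 * (ν + 1) * Y x - U x := by linarith [hode x]
      simp only [he]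
      linear_combination (-(x ^ ν) * (2 * x * Y x + ν * U x)) * h4
    · intro x hx
      rw [interior_Ici] at hx
      have hx' : 0 < x := hx
      positivity
  rcases hs.eq_or_lt with h | h
  · rw [← h]; exact he0
  have hev : ∀ᶠ t in nhdsWithin 0 (Set.Ioi 0), 0 < e t :=
    (hec.continuousAt.eventually (lt_mem_nhds he0)).filter_mono nhdsWithin_le_nhds
  have hev2 : ∀ᶠ t in nhdsWithin (0:ℝ) (Set.Ioi 0), t ∈ Set.Ioo 0 s := Ioo_mem_nhdsGT h
  obtain ⟨t, ht1, ht2⟩ := (hev.and hev2).exists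
  have := hmono (a := t) (b := s) ht2.1.le h.le ht2.2.le
  have h5 : 0 < t ^ (ν + 1) * e t := mul_pos (Real.rpow_pos_of_pos ht2.1 _) ht1
  have h6 : 0 < s ^ (ν + 1) * e s := lt_of_lt_of_le h5 this
  exact (pos_iff_pos_of_mul_pos h6).1 (Real.rpow_pos_of_pos h _)

lemma m_pos (hν : 1 / 2 ≤ ν) (hU : ∀ s, HasDerivAt U (Y s) s) (hY : ∀ s, HasDerivAt Y (Z s) s)
    (hode : ∀ s, 4 * s * Z s + 4 * (ν + 1) * Y s + U s = 0) (hU0 : U 0 = 1)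
    (s : ℝ) (hs : 0 ≤ s) : 0 < (1 - 2 * ν + s) * (4 * s * Y s ^ 2 + 4 * ν * U s * Y s + U s ^ 2)
      + 2 * U s * (U s + 2 * s * Y s) := by
  set e : ℝ → ℝ := fun s => 4 * s * Y s ^ 2 + 4 * ν * U s * Y s + U s ^ 2 with he
  set m : ℝ → ℝ := fun s => (1 - 2 * ν + s) * e s + 2 * U s * (U s + 2 * s * Y s) with hm
  have hUc : Continuous U := continuous_iff_continuousAt.2 fun s => (hU s).continuousAt
  have hYc : Continuous Y := continuous_iff_continuousAt.2 fun s => (hY s).continuousAt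
  have hec : Continuous e := by simp only [he]; fun_prop
  have hmc : Continuous m := by simp only [hm]; fun_prop
  have hν1 : 0 < ν + 1 := by linarith
  have he0 : 0 < m 0 := by
    have h := hode 0
    rw [hU0] at h
    have hY0 : Y 0 = -1 / (4 * (ν + 1)) := by field_simp; linarith
    have : m 0 = 3 / (ν + 1) := by
      simp only [hm, he, hU0, hY0]; field_simp; ring
    rw [this]; positivity
  have hmono : MonotoneOn (fun s => s ^ ν * m s) (Set.Ici 0) := by
    apply monotoneOn_of_hasDerivWithinAt_nonneg
      (f' := fun s => s ^ (ν - 1) * ((U s + 2 * s * Y s) ^ 2 - (1 - 2 * ν) * e s)) (convex_Ici 0)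
    · exact ((Real.continuous_rpow_const (by linarith)).mul hmc).continuousOn
    · intro x hx
      rw [interior_Ici] at hx
      have hx' : 0 < x := hx
      have h1 := Real.hasDerivAt_rpow_const (x := x) (p := ν) (Or.inl hx'.ne')
      have h2 : HasDerivAt e (4 * Y x ^ 2 + 8 * x * Y x * Z x + 4 * ν * (Y x * Y x + U x * Z x)
          + 2 * U x * Y x) x := by
        have := (((hasDerivAt_id x).const_mul 4).mul ((hY x).pow 2)).add
          (((hU x).mul (hY x)).const_mul (4 * ν)) |>.add ((hU x).pow 2)
        refine hd_congr this (fun t => ?_) ?_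
        · simp [he]; ring
        · simp; ring
      have h2' : HasDerivAt m (e x + (1 - 2 * ν + x) * (4 * Y x ^ 2 + 8 * x * Y x * Z x + 4 * ν * (Y x * Y x + U x * Z x)
          + 2 * U x * Y x) + 2 * Y x * (U x + 2 * x * Y x)
          + 2 * U x * (Y x + 2 * (Y x + x * Z x))) x := by
        have := (((hasDerivAt_id x).const_add (1 - 2 * ν)).mul h2).add
          (((hU x).const_mul 2).mul ((hU x).add (((hasDerivAt_id x).mul (hY x)).const_mul 2)))
        refine hd_congr this (fun t => ?_) ?_
        · simp only [hm, Pi.add_apply, Pi.mul_apply, id]; ring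
        · simp; ring
      have h3 := (h1.mul h2').hasDerivWithinAt (s := interior (Set.Ici 0))
      refine hdw_congr h3 (fun t => rfl) ?_
      have hp : x ^ ν = x ^ (ν - 1) * x := by
        rw [← Real.rpow_add_one hx'.ne']; ring_nf
      rw [hp]
      have h4 : 4 * x * Z x = - 4 * (ν + 1) * Y x - U x := by linarith [hode x]
      simp only [hm, he]
      linear_combination (-(x ^ (ν - 1)) * ((1 - 2 * ν + x) * (2 * x * Y x + ν * U x) + x * U x)) * h4
    · intro x hx
      rw [interior_Ici] at hx
      have hx' : 0 < x := hx
      have := e_pos (by linarith) hU hY hode hU0 x hx'.le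
      have h7 : 0 ≤ -(1 - 2 * ν) * e x := mul_nonneg (by linarith) this.le
      have h8 : 0 ≤ (U x + 2 * x * Y x) ^ 2 - (1 - 2 * ν) * e x := by nlinarith [sq_nonneg (U x + 2 * x * Y x)]
      exact mul_nonneg (Real.rpow_nonneg hx'.le _) h8
  rcases hs.eq_or_lt with h | h
  · rw [← h]; exact he0
  have hev : ∀ᶠ t in nhdsWithin 0 (Set.Ioi 0), 0 < m t :=
    (hmc.continuousAt.eventually (lt_mem_nhds he0)).filter_mono nhdsWithin_le_nhds
  have hev2 : ∀ᶠ t in nhdsWithin (0:ℝ) (Set.Ioi 0), t ∈ Set.Ioo 0 s := Ioo_mem_nhdsGT h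
  obtain ⟨t, ht1, ht2⟩ := (hev.and hev2).exists
  have := hmono (a := t) (b := s) ht2.1.le h.le ht2.2.le
  have h5 : 0 < t ^ ν * m t := mul_pos (Real.rpow_pos_of_pos ht2.1 _) ht1
  have h6 : 0 < s ^ ν * m s := lt_of_lt_of_le h5 this
  exact (pos_iff_pos_of_mul_pos h6).1 (Real.rpow_pos_of_pos h _)

/-- a strictly monotone function detecting the zeros of the derivative -/
lemma exists_F (hν : -1 < ν) (hU : ∀ s, HasDerivAt U (Y s) s) (hY : ∀ s, HasDerivAt Y (Z s) s)
    (hode : ∀ s, 4 * s * Z s + 4 * (ν + 1) * Y s + U s = 0) (hU0 : U 0 = 1) :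
    ∃ F : ℝ → ℝ, (∀ C : Set ℝ, Convex ℝ C → C ⊆ Set.Ici 0 → (∀ s ∈ C, U s + 2 * s * Y s ≠ 0) →
      StrictMonoOn F C) ∧
      (∀ s, 0 ≤ s → U s + 2 * s * Y s ≠ 0 → s * ((1 - 2 * ν) * Y s - U s / 2) = 0 → F s = 0) := by
  have hUc : Continuous U := continuous_iff_continuousAt.2 fun s => (hU s).continuousAt
  have hYc : Continuous Y := continuous_iff_continuousAt.2 fun s => (hY s).continuousAt
  have hD : ∀ x, HasDerivAt (fun s => U s + 2 * s * Y s) (Y x + 2 * (Y x + x * Z x)) x := by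
    intro x
    have := (hU x).add (((hasDerivAt_id x).mul (hY x)).const_mul 2)
    refine hd_congr this (fun t => ?_) ?_
    · simp; ring
    · simp
  have hr : ∀ x, 0 < x → U x + 2 * x * Y x ≠ 0 → HasDerivAt (fun s => U s / (U s + 2 * s * Y s))
      ((4 * x * Y x ^ 2 + 4 * ν * U x * Y x + U x ^ 2) / (2 * (U x + 2 * x * Y x) ^ 2)) x := by
    intro x hx hx0
    have := (hU x).div (hD x) hx0
    refine hd_congr this (fun t => rfl) ?_
    rw [div_eq_div_iff (by positivity) (by positivity)]
    linear_combination (U x * (U x + 2 * x * Y x) ^ 2) * hode x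
  rcases lt_or_ge ν (1 / 2) with hc | hc
  · refine ⟨fun s => U s / (U s + 2 * s * Y s) - (1 - 2 * ν) / (1 - 2 * ν + s), ?_, ?_⟩
    · intro C hC hC0 hCD
      apply strictMonoOn_of_hasDerivWithinAt_pos hC (f' := fun x =>
        (4 * x * Y x ^ 2 + 4 * ν * U x * Y x + U x ^ 2) / (2 * (U x + 2 * x * Y x) ^ 2)
         + (1 - 2 * ν) / (1 - 2 * ν + x) ^ 2)
      · apply ContinuousOn.sub
        · exact ContinuousOn.div (by fun_prop) (by fun_prop) hCD
        · apply ContinuousOn.div (by fun_prop) (by fun_prop)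
          intro x hx
          have : 0 ≤ x := hC0 hx
          linarith
      · intro x hx
        have hx0 : 0 < x := by
          have := interior_mono hC0 hx
          rwa [interior_Ici] at this
        have hne : 1 - 2 * ν + x ≠ 0 := by linarith
        have h2 := ((hasDerivAt_const x (1 - 2 * ν)).div ((hasDerivAt_id x).const_add (1 - 2 * ν)) hne)
        have := ((hr x hx0 (hCD x (interior_subset hx))).sub h2).hasDerivWithinAt (s := interior C)
        refine hdw_congr this (fun t => rfl) ?_
        simp
        ring
      · intro x hx
        have hx0 : 0 ≤ x := hC0 (interior_subset hx)
        have h1 := e_pos hν hU hY hode hU0 x hx0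
        have h2 : 0 < (U x + 2 * x * Y x) ^ 2 := by
          have := hCD x (interior_subset hx); positivity
        have h3 : 0 < 1 - 2 * ν := by linarith
        have h4 : 0 < 1 - 2 * ν + x := by linarith
        have := div_pos h1 (mul_pos two_pos h2)
        have := div_pos h3 (pow_pos h4 2)
        linarith
    · intro s hs hD0 h
      have h4 : 1 - 2 * ν + s ≠ 0 := by linarith
      simp only
      rw [sub_eq_zero, div_eq_div_iff hD0 h4]
      linear_combination (-2) * h
  · refine ⟨fun s => (1 - 2 * ν + s) * (U s / (U s + 2 * s * Y s)) - (1 - 2 * ν), ?_, ?_⟩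
    · intro C hC hC0 hCD
      apply strictMonoOn_of_hasDerivWithinAt_pos hC (f' := fun x =>
        ((1 - 2 * ν + x) * (4 * x * Y x ^ 2 + 4 * ν * U x * Y x + U x ^ 2)
      + 2 * U x * (U x + 2 * x * Y x)) / (2 * (U x + 2 * x * Y x) ^ 2))
      · apply ContinuousOn.sub _ (by fun_prop)
        apply ContinuousOn.mul (by fun_prop)
        exact ContinuousOn.div (by fun_prop) (by fun_prop) hCD
      · intro x hx
        have hx0 : 0 < x := by
          have := interior_mono hC0 hx
          rwa [interior_Ici] at this
        have hne := hCD x (interior_subset hx)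
        have := ((((hasDerivAt_id x).const_add (1 - 2 * ν)).mul (hr x hx0 hne)).sub_const
          (1 - 2 * ν)).hasDerivWithinAt (s := interior C)
        refine hdw_congr this (fun t => rfl) ?_
        simp only [id]
        field_simp
        ring
      · intro x hx
        have hx0 : 0 ≤ x := hC0 (interior_subset hx)
        have h2 : 0 < (U x + 2 * x * Y x) ^ 2 := by
          have := hCD x (interior_subset hx); positivity
        exact div_pos (m_pos hc hU hY hode hU0 x hx0) (mul_pos two_pos h2)
    · intro s hs hD0 h
      simp only
      rw [sub_eq_zero, ← mul_div_assoc, div_eq_iff hD0]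
      linear_combination (-2) * h

lemma no_common (hν : -1 < ν) (hU : ∀ s, HasDerivAt U (Y s) s) (hY : ∀ s, HasDerivAt Y (Z s) s)
    (hode : ∀ s, 4 * s * Z s + 4 * (ν + 1) * Y s + U s = 0) (hU0 : U 0 = 1)
    (s : ℝ) (hs : 0 < s) (h0 : U s + 2 * s * Y s = 0) (h1 : (1 - 2 * ν) * Y s - U s / 2 = 0) :
    False := by
  have he := e_pos hν hU hY hode hU0 s hs.le
  have hc : 0 < 1 - 2 * ν + s := by
    rcases lt_or_ge ν (1 / 2) with hc | hc
    · linarith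
    · have := m_pos hc hU hY hode hU0 s hs.le
      rw [h0, mul_zero, add_zero] at this
      exact (pos_iff_pos_of_mul_pos this).2 he
  have hy : (1 - 2 * ν + s) * Y s = 0 := by linear_combination h1 + h0 / 2
  have hy0 : Y s = 0 := (mul_eq_zero.1 hy).resolve_left hc.ne'
  have hu0 : U s = 0 := by rw [hy0] at h0; linarith
  rw [hy0, hu0] at he
  simp at he

end ode

lemma Dcal_eq (ν : ℝ) (hν : -1 < ν) (x : ℝ) :
    Dcal ν x = PSer (cf ν) (x ^ 2) + 2 * x ^ 2 * PSer (PDer (cf ν)) (x ^ 2) := by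
  have hb := cf_bd ν hν
  have h1 := ((hb.summable (x ^ 2)).hasSum).add ((hb.shift (x ^ 2)).mul_left 2)
  have h2 : Dcal ν x = ∑' n : ℕ, (cf ν n * (x ^ 2) ^ n + 2 * ((n : ℝ) * cf ν n * (x ^ 2) ^ n)) := by
    rw [Dcal]
    congr 1
    ext n
    simp only [cf]
    rw [← pow_mul]
    ring
  rw [h2, h1.tsum_eq]
  simp only [PSer]
  ring

lemma cf_ode (ν : ℝ) (hν : -1 < ν) (s : ℝ) :
    4 * s * PSer (PDer (PDer (cf ν))) s + 4 * (ν + 1) * PSer (PDer (cf ν)) s + PSer (cf ν) s = 0 := by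
  have hb := cf_bd ν hν
  have h1 := (((hb.der.shift s).mul_left 4).add
    ((hb.der.summable s).hasSum.mul_left (4 * (ν + 1)))).add (hb.summable s).hasSum
  have h2 : HasSum (fun n : ℕ => 4 * ((n : ℝ) * PDer (cf ν) n * s ^ n)
      + 4 * (ν + 1) * (PDer (cf ν) n * s ^ n) + cf ν n * s ^ n) 0 := by
    refine hs_congr (hasSum_zero (α := ℝ) (β := ℕ)) (fun n => ?_)
    simp only [PDer]
    linear_combination s ^ n * cf_rec ν hν n
  have := h1.unique h2
  simp only [PSer] at this ⊢
  linarith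

/-- The zeros of `𝒟_ν'` interlace with those of `𝒟_ν`: there is no zero of `𝒟_ν'` in
`(0, α_{ν,1}]` and exactly one zero in each interval `(α_{ν,n}, α_{ν,n+1})`. -/
theorem Dcal_deriv_zeros_interlace (ν : ℝ) (hν : -1 < ν) (α : ℕ → ℝ)
    (hαpos : ∀ n, 1 ≤ n → 0 < α n)
    (hαmono : ∀ m n, 1 ≤ m → m < n → α m < α n)
    (hαzero : ∀ n, 1 ≤ n → Dcal ν (α n) = 0)
    (hαall : ∀ x : ℝ, 0 < x → Dcal ν x = 0 → ∃ n, 1 ≤ n ∧ x = α n) :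
    (∀ x : ℝ, 0 < x → x ≤ α 1 → deriv (Dcal ν) x ≠ 0) ∧
    (∀ n, 1 ≤ n → ∃! x : ℝ, x ∈ Set.Ioo (α n) (α (n + 1)) ∧ deriv (Dcal ν) x = 0) := by
  have hb := cf_bd ν hν
  have hU := fun s => hb.hasDerivAt s
  have hY := fun s => hb.der.hasDerivAt s
  have hode := cf_ode ν hν
  have hU0 : PSer (cf ν) 0 = 1 := by rw [PSer_zero, cf_zero ν hν]
  obtain ⟨F, hF, hF0⟩ := exists_F hν hU hY hode hU0
  have hDe := Dcal_eq ν hν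
  have hnc := no_common hν hU hY hode hU0
  have hder : ∀ x, HasDerivAt (Dcal ν)
      (2 * x * ((1 - 2 * ν) * PSer (PDer (cf ν)) (x ^ 2) - PSer (cf ν) (x ^ 2) / 2)) x := by
    intro x
    have hs : HasDerivAt (fun x : ℝ => x ^ 2) (2 * x) x := by simpa using hasDerivAt_pow 2 x
    have h1 := (hU (x ^ 2)).comp x hs
    have h2 := (hY (x ^ 2)).comp x hs
    have h3 := h1.add ((hs.mul h2).const_mul 2)
    refine hd_congr h3 (fun t => ?_) ?_
    · simp only [hDe, Pi.add_apply, Pi.mul_apply, Function.comp]; ring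
    · simp only [Function.comp]
      linear_combination (-x) * hode (x ^ 2)
  have hzero : ∀ x, 0 < x → deriv (Dcal ν) x = 0 →
      (1 - 2 * ν) * PSer (PDer (cf ν)) (x ^ 2) - PSer (cf ν) (x ^ 2) / 2 = 0 := by
    intro x hx h
    rw [(hder x).deriv] at h
    exact (mul_eq_zero.1 h).resolve_left (by positivity)
  have hsq : ∀ s, 0 ≤ s → Dcal ν (√s) = PSer (cf ν) s + 2 * s * PSer (PDer (cf ν)) s := by
    intro s hs; rw [hDe, Real.sq_sqrt hs]
  have hmono' : ∀ m n, 1 ≤ m → m ≤ n → α m ≤ α n := by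
    intro m n hm hmn
    rcases hmn.eq_or_lt with h | h
    · rw [h]
    · exact (hαmono m n hm h).le
  constructor
  · intro x hx hx1 hd
    have hz := hzero x hx hd
    by_cases hD : Dcal ν x = 0
    · rw [hDe] at hD
      exact hnc (x ^ 2) (by positivity) hD hz
    · have hxlt : x < α 1 := lt_of_le_of_ne hx1 (fun h => hD (h ▸ hαzero 1 le_rfl))
      have hne : ∀ s ∈ Set.Icc 0 (x ^ 2), PSer (cf ν) s + 2 * s * PSer (PDer (cf ν)) s ≠ 0 := by
        intro s hs h0
        rcases hs.1.eq_or_lt with h | h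
        · rw [← h, hU0] at h0; simp at h0
        · rw [← hsq s hs.1] at h0
          obtain ⟨n, hn, hn'⟩ := hαall _ (Real.sqrt_pos.2 h) h0
          have h1 := hmono' 1 n le_rfl hn
          have h2 : √s ≤ x := by
            rw [Real.sqrt_le_left hx.le]; exact hs.2
          linarith
      have hm := hF (Set.Icc 0 (x ^ 2)) (convex_Icc _ _) (fun s hs => hs.1) hne
      have hx2 : 0 < x ^ 2 := by positivity
      have hl : (0:ℝ) ∈ Set.Icc 0 (x ^ 2) := ⟨le_rfl, hx2.le⟩
      have hr : x ^ 2 ∈ Set.Icc 0 (x ^ 2) := ⟨hx2.le, le_rfl⟩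
      have h1 := hm hl hr hx2
      rw [hF0 0 le_rfl (hne 0 hl) (by simp), hF0 (x ^ 2) hx2.le (hne _ hr) (by rw [hz, mul_zero])] at h1
      exact lt_irrefl _ h1
  · intro n hn
    have hcont : Continuous (Dcal ν) := continuous_iff_continuousAt.2 fun x => (hder x).continuousAt
    have hlt := hαmono n (n + 1) hn n.lt_succ_self
    have hp := hαpos n hn
    obtain ⟨z, hz, hz0⟩ := exists_deriv_eq_zero hlt hcont.continuousOn
      ((hαzero n hn).trans (hαzero (n + 1) (by omega)).symm)
    refine ⟨z, ⟨hz, hz0⟩, ?_⟩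
    rintro y ⟨hy, hy0⟩
    have hne : ∀ s ∈ Set.Ioo (α n ^ 2) (α (n + 1) ^ 2),
        PSer (cf ν) s + 2 * s * PSer (PDer (cf ν)) s ≠ 0 := by
      intro s hs h0
      have hs0 : 0 < s := lt_trans (by positivity) hs.1
      rw [← hsq s hs0.le] at h0
      obtain ⟨k, hk, hk'⟩ := hαall _ (Real.sqrt_pos.2 hs0) h0
      have h1 : α n < √s := Real.lt_sqrt_of_sq_lt hs.1
      have h2 : √s < α (n + 1) := by
        rw [Real.sqrt_lt' (by linarith)]; exact hs.2
      rcases le_or_gt k n with h | h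
      · have := hmono' k n hk h
        linarith
      · have := hmono' (n + 1) k (by omega) h
        linarith
    have hm := hF _ (convex_Ioo _ _) (fun s hs => (lt_trans (by positivity) hs.1 : 0 < s).le) hne
    have hmem : ∀ t ∈ Set.Ioo (α n) (α (n + 1)), t ^ 2 ∈ Set.Ioo (α n ^ 2) (α (n + 1) ^ 2) := by
      intro t ht
      have := ht.1
      have := ht.2
      constructor <;> nlinarith
    have hval : ∀ t ∈ Set.Ioo (α n) (α (n + 1)), deriv (Dcal ν) t = 0 → F (t ^ 2) = 0 := by
      intro t ht h0
      exact hF0 _ (by positivity) (hne _ (hmem t ht))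
        (by rw [hzero t (hp.trans ht.1) h0, mul_zero])
    have heq : y ^ 2 = z ^ 2 := hm.injOn (hmem y hy) (hmem z hz)
      ((hval y hy hy0).trans (hval z hz hz0).symm)
    have hy1 := hp.trans hy.1
    have hz1 := hp.trans hz.1
    exact (sq_eq_sq₀ hy1.le hz1.le).1 heq
end
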